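/- arXiv:1508.07519 — 2 statements merged into one kernel-verified Lean document; each statement's English description precedes it below -/
import Mathlib

section
/- Let Ω be homogeneous of degree zero on ℝⁿ \ {0} with Ω ∈ L¹(S^{n-1}). Then the following are equivalent: (a) ∫₀¹ ω₁(δ)/δ dδ < ∞, where ω₁(δ) = sup_{‖ρ‖≤δ} ∫_{S^{n-1}} |Ω(ρx′) − Ω(x′)| dσ(x′) with ρ ranging over rotations of ℝⁿ and ‖ρ‖ = sup{|ρx′ − x′| : x′ ∈ S^{n-1}}; (b) ∫₀¹ ω̃₁(δ)/δ dδ < ∞, where ω̃₁(δ) = sup_{|h|≤δ} ∫_{S^{n-1}} |Ω(x′ + h) − Ω(x′)| dσ(x′) with h ∈ ℝⁿ and Ω(x′+h) evaluated via the degree-zero homogeneous extension. -/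
open MeasureTheory Filter Set

noncomputable section

/-- The unit sphere `S^{n-1}` in `ℝⁿ`. -/
abbrev unitSphere (n : ℕ) := Metric.sphere (0 : EuclideanSpace ℝ (Fin n)) 1

/-- The surface (area) measure `σ` on the unit sphere `S^{n-1}`. -/
def sphereMeasure (n : ℕ) : Measure (unitSphere n) :=
  (volume : Measure (EuclideanSpace ℝ (Fin n))).toSphere

/-- `Ω` is homogeneous of degree zero on `ℝⁿ \ {0}`. -/
def HomogeneousZero {n : ℕ} (Ω : EuclideanSpace ℝ (Fin n) → ℝ) : Prop :=
  ∀ c : ℝ, 0 < c → ∀ x : EuclideanSpace ℝ (Fin n), x ≠ 0 → Ω (c • x) = Ω x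

/-- The `L¹` integral modulus of continuity of `Ω`, defined via rotations:
`ω₁(δ) = sup_{‖ρ‖ ≤ δ} ∫_{S^{n-1}} |Ω(ρθ) - Ω(θ)| dσ(θ)`, where `ρ` ranges over
rotations of `ℝⁿ` (linear isometries of determinant `1`) and
`‖ρ‖ = sup{ |ρx' - x'| : x' ∈ S^{n-1} }`. -/
def omegaRot (n : ℕ) (Ω : EuclideanSpace ℝ (Fin n) → ℝ) (δ : ℝ) : ℝ :=
  sSup {I : ℝ | ∃ ρ : EuclideanSpace ℝ (Fin n) ≃ₗᵢ[ℝ] EuclideanSpace ℝ (Fin n),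
    LinearMap.det (ρ.toLinearEquiv : EuclideanSpace ℝ (Fin n) →ₗ[ℝ] EuclideanSpace ℝ (Fin n)) = 1 ∧
    (∀ x : EuclideanSpace ℝ (Fin n), ‖x‖ = 1 → ‖ρ x - x‖ ≤ δ) ∧
    I = ∫ θ : unitSphere n, |Ω (ρ (θ : EuclideanSpace ℝ (Fin n))) - Ω (θ : EuclideanSpace ℝ (Fin n))| ∂(sphereMeasure n)}

/-- The `L¹` integral modulus of continuity of `Ω`, defined via translations:
`ω̃₁(δ) = sup_{|h| ≤ δ} ∫_{S^{n-1}} |Ω(θ + h) - Ω(θ)| dσ(θ)`, where `Ω` is evaluated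
off the sphere via its degree-zero homogeneous extension. -/
def omegaTrans (n : ℕ) (Ω : EuclideanSpace ℝ (Fin n) → ℝ) (δ : ℝ) : ℝ :=
  sSup {I : ℝ | ∃ h : EuclideanSpace ℝ (Fin n), ‖h‖ ≤ δ ∧
    I = ∫ θ : unitSphere n, |Ω ((θ : EuclideanSpace ℝ (Fin n)) + h) - Ω (θ : EuclideanSpace ℝ (Fin n))| ∂(sphereMeasure n)}

/-- `Ω` satisfies the `L¹`-Dini condition. -/
def L1Dini (n : ℕ) (Ω : EuclideanSpace ℝ (Fin n) → ℝ) : Prop :=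
  Integrable (fun θ : unitSphere n => Ω (θ : EuclideanSpace ℝ (Fin n))) (sphereMeasure n) ∧
  ∫⁻ δ in Ioo (0 : ℝ) 1, ENNReal.ofReal (omegaRot n Ω δ / δ) < ⊤

/-- The truncated singular integral `∫_{|x-y| > ε} Ω(x-y)|x-y|^{-n} dμ(y)` of a signed
measure `μ`, where integration against `μ` is via its Jordan decomposition. -/
def truncT (n : ℕ) (Ω : EuclideanSpace ℝ (Fin n) → ℝ)
    (μ : SignedMeasure (EuclideanSpace ℝ (Fin n))) (x : EuclideanSpace ℝ (Fin n)) (ε : ℝ) : ℝ :=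
  (∫ y in {y | ε < ‖x - y‖}, Ω (x - y) / ‖x - y‖ ^ n ∂μ.toJordanDecomposition.posPart) -
  (∫ y in {y | ε < ‖x - y‖}, Ω (x - y) / ‖x - y‖ ^ n ∂μ.toJordanDecomposition.negPart)

/-- The principal-value singular integral `T_Ω μ(x) = p.v. ∫ Ω(x-y)|x-y|^{-n} dμ(y)`. -/
def TOmega (n : ℕ) (Ω : EuclideanSpace ℝ (Fin n) → ℝ)
    (μ : SignedMeasure (EuclideanSpace ℝ (Fin n))) (x : EuclideanSpace ℝ (Fin n)) : ℝ :=
  limUnder (nhdsWithin (0 : ℝ) (Ioi 0)) (truncT n Ω μ x)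

section SphereMaps

open Module Metric
open scoped Pointwise ENNReal NNReal RealInnerProductSpace

variable {E : Type*} [NormedAddCommGroup E] [InnerProductSpace ℝ E] [FiniteDimensional ℝ E]
  [MeasurableSpace E] [BorelSpace E]

theorem LipschitzOnWith.addHaar_image_le {K : ℝ≥0} {T : E → E} {s : Set E}
    (hT : LipschitzOnWith K T s) (μ : Measure E) [μ.IsAddHaarMeasure] :
    μ (T '' s) ≤ (K : ℝ≥0∞) ^ finrank ℝ E * μ s := by
  rw [Measure.isAddLeftInvariant_eq_smul μ (Measure.hausdorffMeasure (finrank ℝ E : ℝ))]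
  have h := hT.hausdorffMeasure_image_le (d := (finrank ℝ E : ℝ)) (Nat.cast_nonneg _)
  rw [ENNReal.rpow_natCast] at h
  simp only [Measure.smul_apply, ENNReal.smul_def, smul_eq_mul]
  rw [mul_left_comm]
  gcongr

/-- If a Lipschitz map on the unit ball carries the cone over `f θ` onto the cone over `θ`, then
`f` does not decrease the spherical measure by more than a constant factor. -/
theorem toSphere_map_le {K : ℝ≥0} {f : sphere (0 : E) 1 → sphere (0 : E) 1} (hf : Measurable f)
    {T : E → E} (hT : LipschitzOnWith K T (ball 0 1))
    (hTf : ∀ θ, ∀ r ∈ Ioo (0 : ℝ) 1, ∃ s ∈ Ioo (0 : ℝ) 1, T (s • (f θ : E)) = r • (θ : E))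
    (μ : Measure E) [μ.IsAddHaarMeasure] :
    μ.toSphere.map f ≤ ((K : ℝ≥0∞) ^ finrank ℝ E) • μ.toSphere := by
  refine Measure.le_iff.2 fun A hA => ?_
  rw [Measure.map_apply hf hA, Measure.smul_apply, smul_eq_mul, Measure.toSphere_apply' _ hA,
    Measure.toSphere_apply' _ (hf hA), mul_left_comm]
  gcongr
  have hsub : Ioo (0 : ℝ) 1 • ((↑) '' A : Set E) ⊆ ball 0 1 := by
    rintro _ ⟨s, hs, _, ⟨a, -, rfl⟩, rfl⟩
    simpa [norm_smul, abs_of_pos hs.1] using hs.2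
  refine le_trans (measure_mono ?_) ((hT.mono hsub).addHaar_image_le μ)
  rintro _ ⟨r, hr, _, ⟨θ, hθ, rfl⟩, rfl⟩
  obtain ⟨s, hs, h⟩ := hTf θ r hr
  exact ⟨s • (f θ : E), smul_mem_smul hs (mem_image_of_mem _ hθ), h⟩

/-- For `‖h‖ ≤ 1`, the positive root `R` of `‖R • y - ‖y‖ • h‖ = ‖y‖` for unit `y`, extended to be
homogeneous of degree one. -/
def shiftRadius (h y : E) : ℝ := ⟪y, h⟫ + √(⟪y, h⟫ ^ 2 + (1 - ‖h‖ ^ 2) * ‖y‖ ^ 2)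

omit [FiniteDimensional ℝ E] [MeasurableSpace E] [BorelSpace E] in
theorem abs_shiftRadius_sub_le {h : E} (hh : ‖h‖ ≤ 1) (x y : E) :
    |shiftRadius h x - shiftRadius h y| ≤ 2 * ‖x - y‖ := by
  have hb : 0 ≤ 1 - ‖h‖ ^ 2 := by nlinarith [norm_nonneg h]
  let L : E → WithLp 2 (ℝ × E) := fun z => WithLp.toLp 2 (⟪z, h⟫, √(1 - ‖h‖ ^ 2) • z)
  have hL : ∀ z, ‖L z‖ = √(⟪z, h⟫ ^ 2 + (1 - ‖h‖ ^ 2) * ‖z‖ ^ 2) := fun z => by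
    simp [L, WithLp.prod_norm_eq_of_L2, norm_smul, mul_pow, Real.sq_sqrt hb]
  have hLsub : L x - L y = L (x - y) := by
    simp [L, ← WithLp.toLp_sub, inner_sub_left, smul_sub]
  have hi : |⟪x - y, h⟫| ≤ ‖x - y‖ * ‖h‖ := abs_real_inner_le_norm _ _
  have h1 : |⟪x, h⟫ - ⟪y, h⟫| ≤ ‖x - y‖ := by
    rw [← inner_sub_left]
    exact hi.trans (mul_le_of_le_one_right (norm_nonneg _) hh)
  have h2 : |‖L x‖ - ‖L y‖| ≤ ‖x - y‖ := by
    refine (abs_norm_sub_norm_le _ _).trans ?_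
    rw [hLsub, hL]
    refine Real.sqrt_le_iff.2 ⟨norm_nonneg _, ?_⟩
    have := sq_le_sq' (by linarith [neg_abs_le ⟪x - y, h⟫]) ((le_abs_self _).trans hi)
    nlinarith
  rw [hL, hL] at h2
  have : shiftRadius h x - shiftRadius h y = (⟪x, h⟫ - ⟪y, h⟫) +
      (√(⟪x, h⟫ ^ 2 + (1 - ‖h‖ ^ 2) * ‖x‖ ^ 2) - √(⟪y, h⟫ ^ 2 + (1 - ‖h‖ ^ 2) * ‖y‖ ^ 2)) := by
    simp only [shiftRadius]; ring
  rw [this]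
  exact (abs_add_le _ _).trans (by linarith)

omit [FiniteDimensional ℝ E] [MeasurableSpace E] [BorelSpace E] in
theorem lipschitzOnWith_shift {h : E} (hh : ‖h‖ ≤ 1) :
    LipschitzOnWith 6 (fun y : E => shiftRadius h y • y - ‖y‖ ^ 2 • h) (ball 0 1) := by
  refine LipschitzOnWith.of_dist_le_mul fun x hx y hy => ?_
  have hx : ‖x‖ ≤ 1 := (mem_ball_zero_iff.1 hx).le
  have hy : ‖y‖ ≤ 1 := (mem_ball_zero_iff.1 hy).le
  rw [dist_eq_norm, dist_eq_norm]
  have e : shiftRadius h x • x - ‖x‖ ^ 2 • h - (shiftRadius h y • y - ‖y‖ ^ 2 • h) =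
      shiftRadius h x • (x - y) + (shiftRadius h x - shiftRadius h y) • y
        - ((‖x‖ - ‖y‖) * (‖x‖ + ‖y‖)) • h := by
    module
  have h0 : |shiftRadius h x| ≤ 2 := by
    have := abs_shiftRadius_sub_le hh x 0
    simp only [shiftRadius, inner_zero_left, norm_zero, sub_zero] at this ⊢
    norm_num at this
    linarith
  have h1 := abs_shiftRadius_sub_le hh x y
  have h2 := abs_norm_sub_norm_le x y
  have h3 : |‖x‖ + ‖y‖| ≤ 2 := by rw [abs_of_nonneg (by positivity)]; linarith
  rw [e]
  refine (norm_sub_le _ _).trans ((add_le_add_left (norm_add_le _ _) _).trans ?_)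
  simp only [norm_smul, Real.norm_eq_abs, abs_mul]
  have a1 : |shiftRadius h x| * ‖x - y‖ ≤ 2 * ‖x - y‖ := by gcongr
  have a2 : |shiftRadius h x - shiftRadius h y| * ‖y‖ ≤ 2 * ‖x - y‖ * 1 := by gcongr
  have a3 : |‖x‖ - ‖y‖| * |‖x‖ + ‖y‖| * ‖h‖ ≤ ‖x - y‖ * 2 * 1 := by gcongr
  norm_num
  linarith

omit [FiniteDimensional ℝ E] [MeasurableSpace E] [BorelSpace E] in
theorem shift_apply {h θ u : E} {s t : ℝ} (hh : ‖h‖ ≤ 1) (hθ : ‖θ‖ = 1) (hu : ‖u‖ = 1)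
    (ht : 0 < t) (hs : 0 < s) (htu : t • u = θ + h) :
    shiftRadius h (s • u) • (s • u) - ‖s • u‖ ^ 2 • h = s ^ 2 • θ := by
  have hθ' : θ = t • u - h := by rw [htu]; abel
  have e1 : t ^ 2 - 2 * t * ⟪u, h⟫ + ‖h‖ ^ 2 = 1 := by
    have := norm_sub_sq_real (t • u) h
    rw [← hθ', hθ, norm_smul, hu, real_inner_smul_left, Real.norm_eq_abs, mul_one, sq_abs] at this
    linarith
  have e2 : 0 ≤ t - ⟪u, h⟫ := by nlinarith [norm_nonneg h]
  have e3 : shiftRadius h (s • u) = s * t := by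
    rw [shiftRadius, real_inner_smul_left, norm_smul, hu, Real.norm_eq_abs, mul_one, sq_abs,
      show (s * ⟪u, h⟫) ^ 2 + (1 - ‖h‖ ^ 2) * s ^ 2 = (s * (t - ⟪u, h⟫)) ^ 2 by
        linear_combination -s ^ 2 * e1, Real.sqrt_sq (by positivity)]
    ring
  rw [e3, norm_smul, hu, Real.norm_eq_abs, mul_one, sq_abs, hθ']
  module

end SphereMaps

section OrthogonalGroup

open Module Metric
open scoped ENNReal NNReal RealInnerProductSpace

variable {E : Type*} [NormedAddCommGroup E] [InnerProductSpace ℝ E] [FiniteDimensional ℝ E]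

theorem compactSpace_unitary : CompactSpace (unitary (E →L[ℝ] E)) := by
  have : ProperSpace (E →L[ℝ] E) := FiniteDimensional.proper ℝ _
  refine isCompact_iff_compactSpace.1 (isCompact_of_isClosed_isBounded isClosed_unitary ?_)
  refine isBounded_iff_forall_norm_le.2 ⟨1, fun u hu => ?_⟩
  refine ContinuousLinearMap.opNorm_le_bound _ zero_le_one fun x => ?_
  rw [one_mul]
  exact (Unitary.norm_map ⟨u, hu⟩ x).le

theorem exists_unitary_apply_eq {θ ξ : E} (hθ : ‖θ‖ = 1) (hξ : ‖ξ‖ = 1) (h0 : θ + ξ ≠ 0) :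
    ∃ τ : unitary (E →L[ℝ] E), (τ : E →L[ℝ] E) θ = ξ ∧ ‖(τ : E →L[ℝ] E) - 1‖ ≤ 4 * ‖ξ - θ‖ := by
  obtain ⟨m, hm, u, hu, hmu⟩ : ∃ m : ℝ, 0 < m ∧ ∃ u : E, ‖u‖ = 1 ∧ m • u = θ + ξ :=
    ⟨‖θ + ξ‖, norm_pos_iff.2 h0, ‖θ + ξ‖⁻¹ • (θ + ξ), by
      rw [norm_smul, norm_inv, norm_norm, inv_mul_cancel₀ (norm_ne_zero_iff.2 h0)],
      smul_inv_smul₀ (norm_ne_zero_iff.2 h0) _⟩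
  have hR : ∀ v : E, ‖v‖ = 1 → ∀ x, (ℝ ∙ v).reflection x = (2 * ⟪v, x⟫) • v - x := fun v hv x => by
    rw [Submodule.reflection_singleton_apply, hv]
    simp [two_smul, two_mul, add_smul]
  have hξ' : ξ = m • u - θ := by rw [hmu]; abel
  have hm2 : 2 * ⟪u, θ⟫ = m := by
    have := norm_sub_sq_real (m • u) θ
    rw [← hξ', hξ, norm_smul, hu, hθ, real_inner_smul_left, Real.norm_eq_abs, mul_one, sq_abs]
      at this
    exact mul_left_cancel₀ hm.ne' (by linarith)
  refine ⟨Unitary.linearIsometryEquiv.symm ((ℝ ∙ θ).reflection.trans (ℝ ∙ u).reflection), ?_, ?_⟩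
  · change (ℝ ∙ u).reflection ((ℝ ∙ θ).reflection θ) = ξ
    rw [hR θ hθ, real_inner_self_eq_norm_sq, hθ, hR u hu, hξ', ← hm2]
    norm_num [two_smul]
  · have hd : ‖u - θ‖ ≤ ‖ξ - θ‖ := by
      have e1 : u - θ = (1 - m / 2) • u + (1 / 2 : ℝ) • (ξ - θ) := by rw [hξ']; module
      have e2 : ‖(1 - m / 2) • u‖ ≤ ‖(1 / 2 : ℝ) • (ξ - θ)‖ := by
        have := abs_norm_sub_norm_le θ ((m / 2) • u)
        rw [show θ - (m / 2) • u = -((1 / 2 : ℝ) • (ξ - θ)) by rw [hξ']; module, norm_neg, hθ,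
          norm_smul, hu, Real.norm_eq_abs, abs_of_pos (half_pos hm), mul_one] at this
        rwa [norm_smul, hu, mul_one]
      rw [e1]
      refine (norm_add_le _ _).trans ?_
      have e3 : ‖(1 / 2 : ℝ) • (ξ - θ)‖ = 1 / 2 * ‖ξ - θ‖ := by rw [norm_smul]; norm_num
      linarith
    refine ContinuousLinearMap.opNorm_le_bound _ (by positivity) fun x => ?_
    change ‖(ℝ ∙ u).reflection ((ℝ ∙ θ).reflection x) - x‖ ≤ _
    set y := (ℝ ∙ θ).reflection x with hy
    have hyx : ‖y‖ = ‖x‖ := LinearIsometryEquiv.norm_map _ _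
    have hx : x = (ℝ ∙ θ).reflection y := by rw [hy, Submodule.reflection_reflection]
    rw [← hyx, hx, hR u hu, hR θ hθ]
    have e : (2 * ⟪u, y⟫) • u - y - ((2 * ⟪θ, y⟫) • θ - y) =
        (2 * ⟪u, y⟫) • (u - θ) + (2 * ⟪u - θ, y⟫) • θ := by
      rw [inner_sub_left]; module
    rw [e]
    refine (norm_add_le _ _).trans ?_
    have i1 := abs_real_inner_le_norm u y
    have i2 := abs_real_inner_le_norm (u - θ) y
    rw [hu, one_mul] at i1
    simp only [norm_smul, Real.norm_eq_abs, abs_mul, abs_two, hθ, mul_one]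
    have b1 : 2 * |⟪u, y⟫| * ‖u - θ‖ ≤ 2 * ‖y‖ * ‖ξ - θ‖ := by gcongr
    have b2 : ‖u - θ‖ * ‖y‖ ≤ ‖ξ - θ‖ * ‖y‖ := by gcongr
    linarith

theorem exists_pos_det_eq_one : ∃ ε > 0, ∀ ρ : E ≃ₗᵢ[ℝ] E,
    ‖(ρ : E →L[ℝ] E) - 1‖ < ε → LinearMap.det (ρ.toLinearEquiv : E →ₗ[ℝ] E) = 1 := by
  have hc : ContinuousAt (fun f : E →L[ℝ] E => f.det) 1 :=
    ContinuousLinearMap.continuous_det.continuousAt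
  have h1 : (1 : E →L[ℝ] E).det = 1 := by simp [ContinuousLinearMap.det]
  have hpos : ∀ᶠ f in nhds (1 : E →L[ℝ] E), 0 < f.det :=
    hc.eventually (lt_mem_nhds (by beta_reduce; rw [h1]; exact one_pos))
  obtain ⟨ε, hε, h⟩ := Metric.eventually_nhds_iff.1 hpos
  refine ⟨ε, hε, fun ρ hρ => ?_⟩
  have hp : 0 < LinearMap.det (ρ.toLinearEquiv : E →ₗ[ℝ] E) :=
    h (y := (ρ : E →L[ℝ] E)) (by rwa [dist_eq_norm])
  rw [← abs_of_pos hp, ← LinearMap.normDet_eq_abs_det]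
  exact ρ.toLinearIsometry.normDet_eq_one

theorem exists_finset_cover_unitary {r : ℝ} (hr : 0 < r) :
    ∃ s : Finset (unitary (E →L[ℝ] E)), s.card ≤ 5 ^ finrank ℝ (E →L[ℝ] E) ∧
      ∀ g : unitary (E →L[ℝ] E), ‖(g : E →L[ℝ] E) - 1‖ ≤ 2 * r →
        ∃ a ∈ s, ‖(g : E →L[ℝ] E) - a‖ ≤ r := by
  classical
  let P : Finset (unitary (E →L[ℝ] E)) → Prop := fun s =>
    (∀ g ∈ s, ‖(g : E →L[ℝ] E) - 1‖ ≤ 2 * r) ∧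
      ∀ a ∈ s, ∀ b ∈ s, a ≠ b → r ≤ ‖(a : E →L[ℝ] E) - b‖
  have hcard : ∀ s, P s → s.card ≤ 5 ^ finrank ℝ (E →L[ℝ] E) := fun s hs => by
    let F : unitary (E →L[ℝ] E) → (E →L[ℝ] E) := fun g => r⁻¹ • ((g : E →L[ℝ] E) - 1)
    have hF : Function.Injective F := fun a b hab =>
      Subtype.ext (sub_left_injective (smul_right_injective _ (inv_ne_zero hr.ne') hab))
    rw [← Finset.card_image_of_injective s hF]
    refine Besicovitch.card_le_of_separated _ ?_ ?_
    · simp only [Finset.forall_mem_image]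
      intro g hg
      rw [norm_smul, norm_inv, Real.norm_of_nonneg hr.le, inv_mul_le_iff₀ hr, mul_comm]
      exact hs.1 g hg
    · simp only [Finset.forall_mem_image]
      intro a ha b hb hab
      have e : F a - F b = r⁻¹ • ((a : E →L[ℝ] E) - b) := by simp only [F]; module
      rw [e, norm_smul, norm_inv, Real.norm_of_nonneg hr.le, le_inv_mul_iff₀ hr, mul_one]
      exact hs.2 a ha b hb fun h => hab (congrArg F h)
  let C : Set ℕ := {k | ∃ s, P s ∧ s.card = k}
  have hC : BddAbove C := ⟨_, by rintro _ ⟨s, hs, rfl⟩; exact hcard s hs⟩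
  obtain ⟨s, hs, hsk⟩ : sSup C ∈ C := Nat.sSup_mem ⟨0, ∅, by simp [P], rfl⟩ hC
  refine ⟨s, hcard s hs, fun g hg => ?_⟩
  by_contra! hcon
  have hgs : g ∉ s := fun h => absurd (hcon g h) (by simp [hr.le])
  have : (insert g s).card ∈ C := by
    refine ⟨_, ⟨?_, ?_⟩, rfl⟩
    · simpa [hg] using fun a ha h => hs.1 ⟨a, ha⟩ h
    · intro a ha b hb hab
      rcases Finset.mem_insert.1 ha with rfl | ha' <;> rcases Finset.mem_insert.1 hb with rfl | hb'
      · exact absurd rfl hab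
      · exact (hcon b hb').le
      · rw [norm_sub_rev]; exact (hcon a ha').le
      · exact hs.2 a ha' b hb' hab
  have := le_csSup hC this
  rw [Finset.card_insert_of_notMem hgs] at this
  omega

theorem unitary_doubling [MeasurableSpace (unitary (E →L[ℝ] E))]
    [BorelSpace (unitary (E →L[ℝ] E))] (ν : Measure (unitary (E →L[ℝ] E)))
    [ν.IsMulLeftInvariant] {r : ℝ} (hr : 0 < r) :
    ν {g | ‖(g : E →L[ℝ] E) - 1‖ ≤ 2 * r} ≤
      5 ^ finrank ℝ (E →L[ℝ] E) * ν {g | ‖(g : E →L[ℝ] E) - 1‖ ≤ r} := by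
  obtain ⟨s, hs, hcov⟩ := exists_finset_cover_unitary (E := E) hr
  set U := {g : unitary (E →L[ℝ] E) | ‖(g : E →L[ℝ] E) - 1‖ ≤ r}
  calc ν {g | ‖(g : E →L[ℝ] E) - 1‖ ≤ 2 * r}
      ≤ ν (⋃ a ∈ s, (fun g => a⁻¹ * g) ⁻¹' U) := measure_mono fun g hg => by
        obtain ⟨a, ha, h⟩ := hcov g hg
        refine mem_biUnion ha ?_
        have e : ((a⁻¹ * g : unitary (E →L[ℝ] E)) : E →L[ℝ] E) - 1 =
            ((a⁻¹ : unitary (E →L[ℝ] E)) : E →L[ℝ] E) * ((g : E →L[ℝ] E) - a) := by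
          rw [mul_sub, ← Submonoid.coe_mul, ← Submonoid.coe_mul, inv_mul_cancel]; rfl
        rw [mem_preimage, mem_ofPred_eq, e, CStarRing.norm_coe_unitary_mul]
        exact h
    _ ≤ ∑ a ∈ s, ν ((fun g => a⁻¹ * g) ⁻¹' U) := measure_biUnion_finset_le _ _
    _ = s.card * ν U := by simp [measure_preimage_mul]
    _ ≤ _ := by
      gcongr
      exact_mod_cast hs

end OrthogonalGroup

section Averaging

open Module Metric
open scoped ENNReal NNReal RealInnerProductSpace

/-- If the perturbations `k x g`, `g ∈ V`, are all close to `w x` in `L¹`, and averaging `k x` over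
`U` is dominated by averaging `k (f x)` over `V`, then `w ∘ f` is close to `w` in `L¹`. -/
theorem lintegral_comp_sub_le_of_average {X G : Type*} [MeasurableSpace X] [MeasurableSpace G]
    {σ : Measure X} [SFinite σ] {ν : Measure G} [SFinite ν] {k : X → G → ℝ}
    (hk : Measurable (Function.uncurry k)) {w : X → ℝ} (hw : Measurable w)
    {f : X → X} (hf : Measurable f) {U V : Set G} (hUV : U ⊆ V) (hU0 : ν U ≠ 0) (hUt : ν U ≠ ⊤)
    {D K M : ℝ≥0∞} (hD : ν V ≤ D * ν U)
    (hσ : ∀ F : X → ℝ≥0∞, Measurable F → ∫⁻ x, F (f x) ∂σ ≤ K * ∫⁻ x, F x ∂σ)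
    (hT : ∀ x b, ∫⁻ g in U, ‖k x g - b‖ₑ ∂ν ≤ ∫⁻ g in V, ‖k (f x) g - b‖ₑ ∂ν)
    (hM : ∀ g ∈ V, ∫⁻ x, ‖k x g - w x‖ₑ ∂σ ≤ M) :
    ∫⁻ x, ‖w (f x) - w x‖ₑ ∂σ ≤ (1 + K * D) * M := by
  have m1 : Measurable (Function.uncurry fun x g => ‖k x g - w x‖ₑ) :=
    (hk.sub (by fun_prop)).enorm
  have m2 : ∀ S : Set G, Measurable fun x => ∫⁻ g in S, ‖k x g - w x‖ₑ ∂ν :=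
    fun S => m1.lintegral_prod_right'
  have pt : ∀ x, ν U * ‖w (f x) - w x‖ₑ ≤
      (∫⁻ g in U, ‖k x g - w x‖ₑ ∂ν) + ∫⁻ g in V, ‖k (f x) g - w (f x)‖ₑ ∂ν := fun x => by
    refine le_trans ?_ (add_le_add le_rfl (hT x _))
    have hkx : Measurable (k x) := hk.of_uncurry_left
    rw [← lintegral_add_left (by fun_prop)]
    calc ν U * ‖w (f x) - w x‖ₑ = ∫⁻ _ in U, ‖w (f x) - w x‖ₑ ∂ν := by simp [mul_comm]
      _ ≤ _ := lintegral_mono fun g => by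
        rw [show w (f x) - w x = (k x g - w x) - (k x g - w (f x)) by ring]
        exact enorm_sub_le
  refine (ENNReal.mul_le_mul_iff_right hU0 hUt).1 ?_
  rw [← lintegral_const_mul _ (by fun_prop)]
  refine (lintegral_mono pt).trans ?_
  rw [lintegral_add_left (m2 U)]
  calc _ ≤ (∫⁻ x, ∫⁻ g in U, ‖k x g - w x‖ₑ ∂ν ∂σ) +
        K * ∫⁻ x, ∫⁻ g in V, ‖k x g - w x‖ₑ ∂ν ∂σ :=
      add_le_add_right (hσ _ (m2 V)) _
    _ = (∫⁻ g in U, ∫⁻ x, ‖k x g - w x‖ₑ ∂σ ∂ν) +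
        K * ∫⁻ g in V, ∫⁻ x, ‖k x g - w x‖ₑ ∂σ ∂ν := by
      rw [lintegral_lintegral_swap (μ := σ) (ν := ν.restrict U) m1.aemeasurable,
        lintegral_lintegral_swap (μ := σ) (ν := ν.restrict V) m1.aemeasurable]
    _ ≤ (∫⁻ _ in U, M ∂ν) + K * ∫⁻ _ in V, M ∂ν := by
      refine add_le_add ?_ (mul_le_mul_right ?_ _)
      · exact setLIntegral_mono measurable_const fun g hg => hM g (hUV hg)
      · exact setLIntegral_mono measurable_const fun g hg => hM g hg
    _ ≤ M * ν U + K * (M * (D * ν U)) := by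
      rw [setLIntegral_const, setLIntegral_const]
      gcongr
    _ = _ := by ring

variable {E : Type*} [NormedAddCommGroup E] [InnerProductSpace ℝ E] [FiniteDimensional ℝ E]
  [MeasurableSpace E] [BorelSpace E]

theorem lintegral_comp_sub_le_of_translation {σ : Measure (sphere (0 : E) 1)} [SFinite σ]
    {w : E → ℝ} (hw : Measurable w) {f : sphere (0 : E) 1 → sphere (0 : E) 1} (hf : Measurable f)
    {δ : ℝ} (hδ : 0 < δ) (hfδ : ∀ θ, ‖(f θ : E) - θ‖ ≤ δ) {K M : ℝ≥0∞}
    (hσ : ∀ F : sphere (0 : E) 1 → ℝ≥0∞, Measurable F → ∫⁻ θ, F (f θ) ∂σ ≤ K * ∫⁻ θ, F θ ∂σ)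
    (hM : ∀ h : E, ‖h‖ ≤ 2 * δ → ∫⁻ θ : sphere (0 : E) 1, ‖w (θ + h) - w θ‖ₑ ∂σ ≤ M) :
    ∫⁻ θ, ‖w (f θ) - w θ‖ₑ ∂σ ≤ (1 + K * 2 ^ finrank ℝ E) * M := by
  let μ : Measure E := Measure.addHaar
  refine lintegral_comp_sub_le_of_average (X := sphere (0 : E) 1) (ν := μ) (w := fun θ => w θ)
    (k := fun θ h => w (θ + h)) (U := closedBall 0 δ) (V := closedBall 0 (2 * δ)) (by fun_prop)
    (by fun_prop) hf (closedBall_subset_closedBall (by linarith))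
    (measure_closedBall_pos μ 0 hδ).ne' measure_closedBall_lt_top.ne ?_ hσ (fun θ b => ?_)
    fun h hh => hM h (mem_closedBall_zero_iff.1 hh)
  · rw [Measure.addHaar_closedBall_mul μ 0 two_pos.le hδ.le]
    norm_num [ENNReal.ofReal_pow]
  · rw [← lintegral_indicator isClosed_closedBall.measurableSet,
      ← lintegral_indicator isClosed_closedBall.measurableSet,
      ← lintegral_add_left_eq_self (μ := μ) ((closedBall 0 (2 * δ)).indicator _) ((θ : E) - f θ)]
    refine lintegral_mono fun h => indicator_apply_le' (fun hh => ?_) fun _ => zero_le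
    have : (θ : E) - f θ + h ∈ closedBall 0 (2 * δ) := by
      have h1 := hfδ θ
      rw [norm_sub_rev] at h1
      have h2 : ‖h‖ ≤ δ := mem_closedBall_zero_iff.1 hh
      exact mem_closedBall_zero_iff.2 ((norm_add_le _ _).trans (by linarith))
    rw [indicator_of_mem this, show (f θ : E) + ((θ : E) - f θ + h) = θ + h by abel]

theorem lintegral_comp_sub_le_of_unitary
    {σ : Measure (sphere (0 : E) 1)} [SFinite σ] {w : E → ℝ} (hw : Measurable w)
    {f : sphere (0 : E) 1 → sphere (0 : E) 1} (hf : Measurable f) {r : ℝ} (hr : 0 < r)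
    (hfτ : ∀ θ : sphere (0 : E) 1, ∃ τ : unitary (E →L[ℝ] E),
      (τ : E →L[ℝ] E) θ = f θ ∧ ‖(τ : E →L[ℝ] E) - 1‖ ≤ r)
    {K M : ℝ≥0∞}
    (hσ : ∀ F : sphere (0 : E) 1 → ℝ≥0∞, Measurable F → ∫⁻ θ, F (f θ) ∂σ ≤ K * ∫⁻ θ, F θ ∂σ)
    (hM : ∀ g : unitary (E →L[ℝ] E), ‖(g : E →L[ℝ] E) - 1‖ ≤ 2 * r →
      ∫⁻ θ : sphere (0 : E) 1, ‖w (((g⁻¹ : unitary (E →L[ℝ] E)) : E →L[ℝ] E) θ) - w θ‖ₑ ∂σ ≤ M) :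
    ∫⁻ θ, ‖w (f θ) - w θ‖ₑ ∂σ ≤ (1 + K * 5 ^ finrank ℝ (E →L[ℝ] E)) * M := by
  have := compactSpace_unitary (E := E)
  borelize ↥(unitary (E →L[ℝ] E))
  let ν : Measure (unitary (E →L[ℝ] E)) := Measure.haar
  have hcont : Continuous fun g : unitary (E →L[ℝ] E) => ‖(g : E →L[ℝ] E) - 1‖ := by fun_prop
  have hact : Continuous fun p : sphere (0 : E) 1 × unitary (E →L[ℝ] E) =>
      ((p.2⁻¹ : unitary (E →L[ℝ] E)) : E →L[ℝ] E) p.1 := by fun_prop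
  refine lintegral_comp_sub_le_of_average (X := sphere (0 : E) 1) (ν := ν) (w := fun θ => w θ)
    (k := fun θ g => w (((g⁻¹ : unitary (E →L[ℝ] E)) : E →L[ℝ] E) θ))
    (U := {g | ‖(g : E →L[ℝ] E) - 1‖ ≤ r}) (V := {g | ‖(g : E →L[ℝ] E) - 1‖ ≤ 2 * r})
    (hw.comp hact.measurable) (by fun_prop) hf (fun g (hg : _ ≤ r) => hg.trans (by linarith))
    ?_ (measure_ne_top _ _) (unitary_doubling ν hr) hσ (fun θ b => ?_) hM
  · have hpos := (isOpen_lt hcont (continuous_const (y := r))).measure_pos ν ⟨1, by simpa using hr⟩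
    exact (hpos.trans_le (measure_mono fun g (hg : _ < r) => hg.le)).ne'
  · obtain ⟨τ, hτ, hτr⟩ := hfτ θ
    rw [← lintegral_indicator (isClosed_le hcont continuous_const).measurableSet,
      ← lintegral_indicator (isClosed_le hcont continuous_const).measurableSet,
      ← lintegral_mul_left_eq_self (μ := ν) (indicator {g | ‖(g : E →L[ℝ] E) - 1‖ ≤ 2 * r} _) τ]
    refine lintegral_mono fun g => indicator_apply_le' (fun hg => ?_) fun _ => zero_le
    have hmem : τ * g ∈ {g : unitary (E →L[ℝ] E) | ‖(g : E →L[ℝ] E) - 1‖ ≤ 2 * r} := by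
      have e : ((τ * g : unitary (E →L[ℝ] E)) : E →L[ℝ] E) - 1 =
          (τ : E →L[ℝ] E) * ((g : E →L[ℝ] E) - 1) + ((τ : E →L[ℝ] E) - 1) := by
        rw [Submonoid.coe_mul]; noncomm_ring
      have h2 : ‖(g : E →L[ℝ] E) - 1‖ ≤ r := hg
      rw [mem_ofPred_eq, e]
      refine (norm_add_le _ _).trans ?_
      rw [CStarRing.norm_coe_unitary_mul]
      linarith
    have hact' : (((τ * g)⁻¹ : unitary (E →L[ℝ] E)) : E →L[ℝ] E) (f θ) =
        ((g⁻¹ : unitary (E →L[ℝ] E)) : E →L[ℝ] E) θ := by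
      rw [← hτ, ← mul_apply_eq_comp, ← Submonoid.coe_mul]
      congr 2
      group
    rw [indicator_of_mem hmem, hact']

end Averaging

section Bridging

open Module Metric
open scoped ENNReal NNReal RealInnerProductSpace

theorem lintegral_div_lt_top_of_le_comp_mul {f g : ℝ → ℝ} {a c C M : ℝ} (ha : 0 < a) (hc : 0 < c)
    (hac : a * c ≤ 1) (hC : 0 ≤ C) (h1 : ∀ δ ∈ Ioo 0 c, g δ ≤ C * f (a * δ))
    (h2 : ∀ δ ∈ Ioo (0 : ℝ) 1, g δ ≤ M)
    (hf : ∫⁻ δ in Ioo (0 : ℝ) 1, ENNReal.ofReal (f δ / δ) < ⊤) :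
    ∫⁻ δ in Ioo (0 : ℝ) 1, ENNReal.ofReal (g δ / δ) < ⊤ := by
  have hsub : Ioo (0 : ℝ) 1 ⊆ Ioo 0 c ∪ Ico c 1 := fun x hx => by
    rcases lt_or_ge x c with h | h
    · exact Or.inl ⟨hx.1, h⟩
    · exact Or.inr ⟨h, hx.2⟩
  refine (lintegral_mono_set hsub).trans_lt ((lintegral_union_le _ _ _).trans_lt
    (ENNReal.add_lt_top.2 ⟨?_, ?_⟩))
  · let H : ℝ → ℝ≥0∞ := fun y => ENNReal.ofReal (f y / y)
    calc ∫⁻ δ in Ioo 0 c, ENNReal.ofReal (g δ / δ)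
        ≤ ∫⁻ δ in Ioo 0 c, ENNReal.ofReal (C * a) * H (a * δ) := by
          refine setLIntegral_mono' measurableSet_Ioo fun δ hδ => ?_
          rw [← ENNReal.ofReal_mul (by positivity)]
          refine ENNReal.ofReal_le_ofReal ?_
          rw [div_le_iff₀ hδ.1]
          refine (h1 δ hδ).trans_eq ?_
          have := hδ.1.ne'
          field_simp
      _ = ENNReal.ofReal (C * a) * ∫⁻ δ, (Ioo 0 (a * c)).indicator H (a * δ) := by
          rw [lintegral_const_mul' _ _ ENNReal.ofReal_ne_top,
            ← lintegral_indicator measurableSet_Ioo]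
          congr 1
          refine lintegral_congr fun δ => ?_
          simp only [indicator, mem_Ioo, mul_pos_iff_of_pos_left ha, mul_lt_mul_iff_right₀ ha]
      _ = ENNReal.ofReal (C * a) * (ENNReal.ofReal |a⁻¹| * ∫⁻ δ in Ioo 0 (a * c), H δ) := by
          rw [← (measurableEmbedding_mulLeft₀ ha.ne').lintegral_map,
            Real.map_volume_mul_left ha.ne',
            lintegral_smul_measure, lintegral_indicator measurableSet_Ioo, smul_eq_mul]
      _ < ⊤ := ENNReal.mul_lt_top ENNReal.ofReal_lt_top (ENNReal.mul_lt_top ENNReal.ofReal_lt_top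
          ((lintegral_mono_set (Ioo_subset_Ioo_right hac)).trans_lt hf))
  · calc ∫⁻ δ in Ico c 1, ENNReal.ofReal (g δ / δ)
        ≤ ∫⁻ _ in Ico c 1, ENNReal.ofReal (|M| / c) := by
          refine setLIntegral_mono' measurableSet_Ico fun δ hδ => ENNReal.ofReal_le_ofReal ?_
          have hδ0 : 0 < δ := hc.trans_le hδ.1
          have := (h2 δ ⟨hδ0, hδ.2⟩).trans (le_abs_self M)
          gcongr
          exact hδ.1
      _ < ⊤ := by
          rw [setLIntegral_const]
          exact ENNReal.mul_lt_top ENNReal.ofReal_lt_top measure_Ico_lt_top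

theorem ofReal_integral_comp_sub {X : Type*} [MeasurableSpace X] {σ : Measure X} {a b : X → ℝ}
    (ha : Integrable a σ) (hb : Measurable b) (hab : a =ᵐ[σ] b) {f : X → X} (hf : Measurable f)
    {K : ℝ≥0∞} (hK : K ≠ ⊤) (hmap : σ.map f ≤ K • σ) :
    ENNReal.ofReal (∫ x, |a (f x) - a x| ∂σ) = ∫⁻ x, ‖b (f x) - b x‖ₑ ∂σ ∧
      ∫ x, |a (f x) - a x| ∂σ ≤ ((K + 1) * ∫⁻ x, ‖a x‖ₑ ∂σ).toReal := by
  have hac : σ.map f ≪ σ := (Measure.absolutelyContinuous_of_le hmap).trans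
    (Measure.smul_absolutelyContinuous)
  have habf : ∀ᵐ x ∂σ, a (f x) = b (f x) := ae_of_ae_map hf.aemeasurable (hac.ae_le hab)
  have hi : Integrable (fun x => a (f x)) σ :=
    ((ha.smul_measure hK).mono_measure hmap).comp_measurable hf
  have hd : Integrable (fun x => a (f x) - a x) σ := hi.sub ha
  have e : ENNReal.ofReal (∫ x, |a (f x) - a x| ∂σ) = ∫⁻ x, ‖b (f x) - b x‖ₑ ∂σ := by
    refine (ofReal_integral_norm_eq_lintegral_enorm hd).trans (lintegral_congr_ae ?_)
    filter_upwards [hab, habf] with x h1 h2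
    rw [h1, h2]
  refine ⟨e, ?_⟩
  have hfin : (K + 1) * ∫⁻ x, ‖a x‖ₑ ∂σ ≠ ⊤ :=
    ENNReal.mul_ne_top (ENNReal.add_ne_top.2 ⟨hK, ENNReal.one_ne_top⟩) ha.2.ne
  rw [← ENNReal.ofReal_le_iff_le_toReal hfin, e]
  calc ∫⁻ x, ‖b (f x) - b x‖ₑ ∂σ ≤ ∫⁻ x, (‖b (f x)‖ₑ + ‖b x‖ₑ) ∂σ :=
        lintegral_mono fun x => enorm_sub_le
    _ = ∫⁻ x, ‖b x‖ₑ ∂(σ.map f) + ∫⁻ x, ‖b x‖ₑ ∂σ := by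
        rw [lintegral_add_left (by fun_prop), lintegral_map (by fun_prop) hf]
    _ ≤ K * ∫⁻ x, ‖b x‖ₑ ∂σ + ∫⁻ x, ‖b x‖ₑ ∂σ := by
        gcongr
        exact (lintegral_mono' hmap le_rfl).trans_eq (lintegral_smul_measure _ _)
    _ = (K + 1) * ∫⁻ x, ‖a x‖ₑ ∂σ := by
        have : ∫⁻ x, ‖a x‖ₑ ∂σ = ∫⁻ x, ‖b x‖ₑ ∂σ :=
          lintegral_congr_ae (hab.mono fun x hx => congrArg enorm hx)
        rw [this, add_mul, one_mul]

theorem lintegral_comp_le_of_map_le {X : Type*} [MeasurableSpace X] {σ : Measure X}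
    {f : X → X} (hf : Measurable f) {K : ℝ≥0∞} (hmap : σ.map f ≤ K • σ) (F : X → ℝ≥0∞)
    (hF : Measurable F) : ∫⁻ x, F (f x) ∂σ ≤ K * ∫⁻ x, F x ∂σ := by
  rw [← lintegral_map hF hf]
  exact (lintegral_mono' hmap le_rfl).trans_eq (lintegral_smul_measure _ _)

theorem exists_measurable_normalize (E : Type*) [NormedAddCommGroup E] [NormedSpace ℝ E]
    [Nontrivial E] [MeasurableSpace E] [BorelSpace E] [SecondCountableTopology E] :
    ∃ N : E → sphere (0 : E) 1, Measurable N ∧ ∀ x ≠ 0, (N x : E) = ‖x‖⁻¹ • x := by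
  classical
  obtain ⟨e, he⟩ := (NormedSpace.sphere_nonempty (x := (0 : E)) (r := 1)).2 zero_le_one
  let N₀ : E → E := fun x => if x = 0 then e else ‖x‖⁻¹ • x
  have hN₀ : ∀ x, N₀ x ∈ sphere (0 : E) 1 := fun x => by
    by_cases hx : x = 0
    · simpa [N₀, hx] using he
    · simp [N₀, hx, norm_smul]
  refine ⟨fun x => ⟨N₀ x, hN₀ x⟩, Measurable.subtype_mk ?_, fun x hx => if_neg hx⟩
  exact Measurable.ite (measurableSet_singleton 0) measurable_const
    (measurable_norm.inv.smul measurable_id)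

end Bridging

section Sphere

open Module Metric
open scoped ENNReal NNReal

variable {E : Type*} [NormedAddCommGroup E] [InnerProductSpace ℝ E] [FiniteDimensional ℝ E]
  [MeasurableSpace E] [BorelSpace E]

/-- The action of a linear isometry on the unit sphere. -/
def sphereRotation (ρ : E ≃ₗᵢ[ℝ] E) (θ : sphere (0 : E) 1) : sphere (0 : E) 1 :=
  ⟨ρ θ, by simp⟩

omit [FiniteDimensional ℝ E] in
theorem measurable_sphereRotation (ρ : E ≃ₗᵢ[ℝ] E) : Measurable (sphereRotation ρ) :=
  Measurable.subtype_mk (by fun_prop)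

theorem toSphere_map_sphereRotation_le (ρ : E ≃ₗᵢ[ℝ] E) (μ : Measure E) [μ.IsAddHaarMeasure] :
    μ.toSphere.map (sphereRotation ρ) ≤ (1 : ℝ≥0∞) • μ.toSphere := by
  have h := toSphere_map_le (K := 1) (measurable_sphereRotation ρ)
    (ρ.symm.lipschitz.lipschitzOnWith (s := ball 0 1))
    (fun θ r hr => ⟨r, hr, by simp [sphereRotation]⟩) μ
  simpa using h

theorem add_ne_zero_of_norm_lt_one {V : Type*} [NormedAddCommGroup V] {h : V} (hh : ‖h‖ < 1)
    (θ : sphere (0 : V) 1) : (θ : V) + h ≠ 0 := fun h0 => by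
  have : ‖(θ : V)‖ = ‖h‖ := by rw [eq_neg_of_add_eq_zero_left h0, norm_neg]
  rw [norm_eq_of_mem_sphere θ] at this
  linarith

variable {N : E → sphere (0 : E) 1} (hN : ∀ x ≠ 0, (N x : E) = ‖x‖⁻¹ • x)

include hN

omit [FiniteDimensional ℝ E] [MeasurableSpace E] [BorelSpace E] in
theorem normalize_coe (θ : sphere (0 : E) 1) : N θ = θ :=
  Subtype.ext (by rw [hN _ (ne_zero_of_mem_unit_sphere θ)]; simp)

omit [FiniteDimensional ℝ E] [MeasurableSpace E] [BorelSpace E] in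
theorem norm_normalize_add_sub_le {h : E} (hh : ‖h‖ < 1) (θ : sphere (0 : E) 1) :
    ‖(N (θ + h) : E) - θ‖ ≤ 2 * ‖h‖ := by
  have h0 := add_ne_zero_of_norm_lt_one hh θ
  have hn := norm_pos_iff.2 h0
  have h1 : ‖(N (θ + h) : E) - (θ + h)‖ ≤ ‖h‖ := by
    have e : (N (θ + h) : E) - (θ + h) = (1 - ‖(θ : E) + h‖) • (N (θ + h) : E) := by
      rw [sub_smul, one_smul, hN _ h0, smul_inv_smul₀ hn.ne']
    rw [e, norm_smul, norm_eq_of_mem_sphere, mul_one]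
    simpa using abs_norm_sub_norm_le (θ : E) (θ + h)
  calc ‖(N (θ + h) : E) - θ‖ = ‖((N (θ + h) : E) - (θ + h)) + h‖ := by congr 1; abel
    _ ≤ _ := (norm_add_le _ _).trans (by linarith)

theorem toSphere_map_normalize_add_le (hNm : Measurable N) {h : E} (hh : ‖h‖ < 1) (μ : Measure E)
    [μ.IsAddHaarMeasure] :
    μ.toSphere.map (fun θ : sphere (0 : E) 1 => N (θ + h)) ≤
      ((6 : ℝ≥0∞) ^ finrank ℝ E) • μ.toSphere := by
  refine toSphere_map_le (K := 6) (by fun_prop) (lipschitzOnWith_shift hh.le)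
    (fun θ r hr => ⟨√r, ⟨Real.sqrt_pos.2 hr.1, ?_⟩, ?_⟩) μ
  · rw [Real.sqrt_lt' one_pos]; simpa using hr.2
  · have h0 := add_ne_zero_of_norm_lt_one hh θ
    have hn := norm_pos_iff.2 h0
    have := shift_apply (s := √r) hh.le (norm_eq_of_mem_sphere θ)
      (norm_eq_of_mem_sphere (N (θ + h))) hn (Real.sqrt_pos.2 hr.1)
      (by rw [hN _ h0, smul_inv_smul₀ hn.ne'])
    rwa [Real.sq_sqrt hr.1.le] at this

end Sphere

section Moduli

open Module Metric
open scoped ENNReal NNReal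

variable {n : ℕ} {Ω : EuclideanSpace ℝ (Fin n) → ℝ}

instance (n : ℕ) : IsFiniteMeasure (sphereMeasure n) :=
  inferInstanceAs (IsFiniteMeasure (volume : Measure (EuclideanSpace ℝ (Fin n))).toSphere)

theorem omegaTrans_nonneg (δ : ℝ) : 0 ≤ omegaTrans n Ω δ := by
  refine Real.sSup_nonneg ?_
  rintro _ ⟨h, -, rfl⟩
  exact integral_nonneg fun _ => abs_nonneg _

theorem omegaRot_nonneg (δ : ℝ) : 0 ≤ omegaRot n Ω δ := by
  refine Real.sSup_nonneg ?_
  rintro _ ⟨ρ, -, -, rfl⟩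
  exact integral_nonneg fun _ => abs_nonneg _

/-- A bound on the two kinds of increments of `Ω` which is uniform in the rotation and in the
translation. -/
def incrementBound (n : ℕ) (Ω : EuclideanSpace ℝ (Fin n) → ℝ) : ℝ :=
  ((6 ^ n + 1) * ∫⁻ θ : unitSphere n, ‖Ω θ‖ₑ ∂(sphereMeasure n)).toReal

variable {N : EuclideanSpace ℝ (Fin n) → unitSphere n} {g : unitSphere n → ℝ}

theorem increment_rotation
    (hint : Integrable (fun θ : unitSphere n => Ω θ) (sphereMeasure n)) (hg : Measurable g)
    (hΩg : (fun θ : unitSphere n => Ω θ) =ᵐ[sphereMeasure n] g)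
    (ρ : EuclideanSpace ℝ (Fin n) ≃ₗᵢ[ℝ] EuclideanSpace ℝ (Fin n)) :
    ENNReal.ofReal (∫ θ : unitSphere n, |Ω (ρ θ) - Ω θ| ∂(sphereMeasure n)) =
        ∫⁻ θ, ‖g (sphereRotation ρ θ) - g θ‖ₑ ∂(sphereMeasure n) ∧
      ∫ θ : unitSphere n, |Ω (ρ θ) - Ω θ| ∂(sphereMeasure n) ≤ incrementBound n Ω := by
  refine ofReal_integral_comp_sub hint hg hΩg (measurable_sphereRotation ρ)
    (ENNReal.pow_ne_top (by simp)) ((toSphere_map_sphereRotation_le ρ volume).trans ?_)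
  intro A
  simp only [Measure.smul_apply, smul_eq_mul]
  gcongr
  · exact one_le_pow₀ (by norm_num)
  · exact le_rfl

theorem increment_translation (hhom : HomogeneousZero Ω)
    (hint : Integrable (fun θ : unitSphere n => Ω θ) (sphereMeasure n)) (hg : Measurable g)
    (hΩg : (fun θ : unitSphere n => Ω θ) =ᵐ[sphereMeasure n] g) (hNm : Measurable N)
    (hN : ∀ x ≠ 0, (N x : EuclideanSpace ℝ (Fin n)) = ‖x‖⁻¹ • x)
    {h : EuclideanSpace ℝ (Fin n)} (hh : ‖h‖ < 1) :
    ENNReal.ofReal (∫ θ : unitSphere n, |Ω (θ + h) - Ω θ| ∂(sphereMeasure n)) =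
        ∫⁻ θ : unitSphere n, ‖g (N (θ + h)) - g θ‖ₑ ∂(sphereMeasure n) ∧
      ∫ θ : unitSphere n, |Ω (θ + h) - Ω θ| ∂(sphereMeasure n) ≤ incrementBound n Ω := by
  have hmap := toSphere_map_normalize_add_le hN hNm hh volume
  rw [finrank_euclideanSpace_fin] at hmap
  have key := ofReal_integral_comp_sub hint hg hΩg (f := fun θ : unitSphere n => N (θ + h))
    (by fun_prop) (ENNReal.pow_ne_top (by simp)) hmap
  have e : ∀ θ : unitSphere n, Ω (N (θ + h)) = Ω (θ + h) := fun θ => by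
    have h0 := add_ne_zero_of_norm_lt_one hh θ
    rw [hN _ h0, hhom _ (inv_pos.2 (norm_pos_iff.2 h0)) _ h0]
  simpa only [e, incrementBound] using key

theorem le_omegaRot (hint : Integrable (fun θ : unitSphere n => Ω θ) (sphereMeasure n))
    (hg : Measurable g) (hΩg : (fun θ : unitSphere n => Ω θ) =ᵐ[sphereMeasure n] g)
    {ρ : EuclideanSpace ℝ (Fin n) ≃ₗᵢ[ℝ] EuclideanSpace ℝ (Fin n)} {δ : ℝ}
    (hdet : LinearMap.det (ρ.toLinearEquiv :
      EuclideanSpace ℝ (Fin n) →ₗ[ℝ] EuclideanSpace ℝ (Fin n)) = 1)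
    (hρ : ∀ x : EuclideanSpace ℝ (Fin n), ‖x‖ = 1 → ‖ρ x - x‖ ≤ δ) :
    ∫⁻ θ, ‖g (sphereRotation ρ θ) - g θ‖ₑ ∂(sphereMeasure n) ≤
      ENNReal.ofReal (omegaRot n Ω δ) := by
  rw [← (increment_rotation hint hg hΩg ρ).1]
  refine ENNReal.ofReal_le_ofReal (le_csSup ⟨incrementBound n Ω, ?_⟩ ⟨ρ, hdet, hρ, rfl⟩)
  rintro _ ⟨ρ, -, -, rfl⟩
  exact (increment_rotation hint hg hΩg ρ).2

theorem le_omegaTrans (hhom : HomogeneousZero Ω)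
    (hint : Integrable (fun θ : unitSphere n => Ω θ) (sphereMeasure n)) (hg : Measurable g)
    (hΩg : (fun θ : unitSphere n => Ω θ) =ᵐ[sphereMeasure n] g) (hNm : Measurable N)
    (hN : ∀ x ≠ 0, (N x : EuclideanSpace ℝ (Fin n)) = ‖x‖⁻¹ • x)
    {h : EuclideanSpace ℝ (Fin n)} {δ : ℝ} (hδ : δ < 1) (hh : ‖h‖ ≤ δ) :
    ∫⁻ θ : unitSphere n, ‖g (N (θ + h)) - g θ‖ₑ ∂(sphereMeasure n) ≤
      ENNReal.ofReal (omegaTrans n Ω δ) := by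
  rw [← (increment_translation hhom hint hg hΩg hNm hN (hh.trans_lt hδ)).1]
  refine ENNReal.ofReal_le_ofReal (le_csSup ⟨incrementBound n Ω, ?_⟩ ⟨h, hh, rfl⟩)
  rintro _ ⟨h, hh, rfl⟩
  exact (increment_translation hhom hint hg hΩg hNm hN (hh.trans_lt hδ)).2

theorem omegaRot_le_omegaTrans (hhom : HomogeneousZero Ω)
    (hint : Integrable (fun θ : unitSphere n => Ω θ) (sphereMeasure n)) (hg : Measurable g)
    (hΩg : (fun θ : unitSphere n => Ω θ) =ᵐ[sphereMeasure n] g) (hNm : Measurable N)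
    (hN : ∀ x ≠ 0, (N x : EuclideanSpace ℝ (Fin n)) = ‖x‖⁻¹ • x)
    {δ : ℝ} (hδ0 : 0 < δ) (hδ : 2 * δ < 1) :
    omegaRot n Ω δ ≤ (1 + 2 ^ n) * omegaTrans n Ω (2 * δ) := by
  have hnn : 0 ≤ (1 + 2 ^ n) * omegaTrans n Ω (2 * δ) :=
    mul_nonneg (by positivity) (omegaTrans_nonneg _)
  refine Real.sSup_le ?_ hnn
  rintro _ ⟨ρ, -, hρ, rfl⟩
  have := lintegral_comp_sub_le_of_translation (σ := sphereMeasure n) (w := fun x => g (N x))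
    (by fun_prop) (measurable_sphereRotation ρ) hδ0
    (fun θ => hρ θ (norm_eq_of_mem_sphere θ))
    (lintegral_comp_le_of_map_le (measurable_sphereRotation ρ)
      (toSphere_map_sphereRotation_le ρ volume))
    (M := ENNReal.ofReal (omegaTrans n Ω (2 * δ)))
    (fun h hh => by
      simpa only [normalize_coe hN] using le_omegaTrans hhom hint hg hΩg hNm hN hδ hh)
  simp only [normalize_coe hN, one_mul, finrank_euclideanSpace_fin] at this
  rw [← (increment_rotation hint hg hΩg ρ).1] at this
  rw [← ENNReal.ofReal_le_ofReal_iff hnn, ENNReal.ofReal_mul (by positivity)]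
  convert this using 2
  rw [ENNReal.ofReal_add zero_le_one (by positivity), ENNReal.ofReal_pow zero_le_two]
  simp

theorem exists_omegaTrans_le_omegaRot (hhom : HomogeneousZero Ω)
    (hint : Integrable (fun θ : unitSphere n => Ω θ) (sphereMeasure n)) (hg : Measurable g)
    (hΩg : (fun θ : unitSphere n => Ω θ) =ᵐ[sphereMeasure n] g) (hNm : Measurable N)
    (hN : ∀ x ≠ 0, (N x : EuclideanSpace ℝ (Fin n)) = ‖x‖⁻¹ • x) :
    ∃ C ≥ 0, ∃ c > 0, 16 * c ≤ 1 ∧ ∀ δ ∈ Ioo 0 c,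
      omegaTrans n Ω δ ≤ C * omegaRot n Ω (16 * δ) := by
  obtain ⟨ε, hε, hdet⟩ := exists_pos_det_eq_one (E := EuclideanSpace ℝ (Fin n))
  set d := finrank ℝ (EuclideanSpace ℝ (Fin n) →L[ℝ] EuclideanSpace ℝ (Fin n))
  refine ⟨1 + 6 ^ n * 5 ^ d, by positivity, min (1 / 16) (ε / 16), by positivity, ?_, ?_⟩
  · linarith [min_le_left (1 / 16) (ε / 16)]
  rintro δ ⟨hδ0, hδ⟩
  have hδ1 : δ < 1 / 16 := hδ.trans_le (min_le_left _ _)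
  have hδε : δ < ε / 16 := hδ.trans_le (min_le_right _ _)
  have hnn : 0 ≤ (1 + 6 ^ n * 5 ^ d) * omegaRot n Ω (16 * δ) :=
    mul_nonneg (by positivity) (omegaRot_nonneg _)
  refine Real.sSup_le ?_ hnn
  rintro _ ⟨h, hh, rfl⟩
  have hh1 : ‖h‖ < 1 := by linarith
  have hmap := toSphere_map_normalize_add_le hN hNm hh1 volume
  rw [finrank_euclideanSpace_fin] at hmap
  have hsub := fun θ => norm_normalize_add_sub_le hN hh1 θ
  have key := lintegral_comp_sub_le_of_unitary (σ := sphereMeasure n) (w := fun x => g (N x))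
    (f := fun θ => N (θ + h)) (r := 8 * δ)
    (M := ENNReal.ofReal (omegaRot n Ω (16 * δ))) (K := 6 ^ n)
    (by fun_prop) (by fun_prop) (by positivity) (fun θ => ?_)
    (lintegral_comp_le_of_map_le (by fun_prop) hmap) (fun u hu => ?_)
  · simp only [normalize_coe hN] at key
    rw [← (increment_translation hhom hint hg hΩg hNm hN hh1).1] at key
    rw [← ENNReal.ofReal_le_ofReal_iff hnn, ENNReal.ofReal_mul (by positivity)]
    convert key using 2
    rw [ENNReal.ofReal_add zero_le_one (by positivity), ENNReal.ofReal_mul (by positivity),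
      ENNReal.ofReal_pow (by positivity), ENNReal.ofReal_pow (by positivity)]
    simp
    rfl
  · have h0 : (θ : EuclideanSpace ℝ (Fin n)) + N (θ + h) ≠ 0 := fun h0 => by
      have e := hsub θ
      rw [← neg_eq_of_add_eq_zero_right h0, ← norm_neg, neg_sub, sub_neg_eq_add, ← two_smul ℝ,
        norm_smul, norm_eq_of_mem_sphere] at e
      norm_num at e
      linarith
    obtain ⟨τ, hτ, hτr⟩ := exists_unitary_apply_eq (norm_eq_of_mem_sphere θ)
      (norm_eq_of_mem_sphere _) h0
    exact ⟨τ, hτ, hτr.trans (by linarith [hsub θ])⟩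
  · let ρ := Unitary.linearIsometryEquiv u⁻¹
    let v : EuclideanSpace ℝ (Fin n) →L[ℝ] EuclideanSpace ℝ (Fin n) := u
    have hdist : ∀ x, ‖ρ x - x‖ ≤ ‖v - 1‖ * ‖x‖ := fun x => by
      have e1 : v (ρ x) = x := (Unitary.linearIsometryEquiv u).apply_symm_apply x
      have e2 := (v - 1).le_opNorm (ρ x)
      rw [sub_apply, e1, ρ.norm_map, norm_sub_rev] at e2
      exact e2
    have hρ1 : ‖(ρ : EuclideanSpace ℝ (Fin n) →L[ℝ] EuclideanSpace ℝ (Fin n)) - 1‖ < ε :=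
      (ContinuousLinearMap.opNorm_le_bound _ (norm_nonneg _) hdist).trans_lt (by linarith)
    have := le_omegaRot hint hg hΩg (δ := 16 * δ) (hdet ρ hρ1) fun x hx => by
      have := hdist x
      rw [hx, mul_one] at this
      linarith
    have e : ∀ θ : unitSphere n, N (((u⁻¹ : unitary (EuclideanSpace ℝ (Fin n) →L[ℝ]
        EuclideanSpace ℝ (Fin n))) : EuclideanSpace ℝ (Fin n) →L[ℝ] _) θ) = sphereRotation ρ θ :=
      fun θ => normalize_coe hN (sphereRotation ρ θ)
    simpa only [e, normalize_coe hN] using this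

end Moduli

/-- For `Ω` homogeneous of degree zero with `Ω ∈ L¹(S^{n-1})`, the
`L¹`-Dini condition defined via rotations is equivalent to the one defined via
translations: `∫₀¹ ω₁(δ)/δ dδ < ∞ ↔ ∫₀¹ ω̃₁(δ)/δ dδ < ∞`. -/
theorem L1Dini_rotation_iff_translation
    {n : ℕ} (hn : 0 < n) (Ω : EuclideanSpace ℝ (Fin n) → ℝ)
    (hhom : HomogeneousZero Ω)
    (hint : Integrable (fun θ : unitSphere n => Ω (θ : EuclideanSpace ℝ (Fin n)))
      (sphereMeasure n)) :
    (∫⁻ δ in Ioo (0 : ℝ) 1, ENNReal.ofReal (omegaRot n Ω δ / δ) < ⊤) ↔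
      (∫⁻ δ in Ioo (0 : ℝ) 1, ENNReal.ofReal (omegaTrans n Ω δ / δ) < ⊤) := by
  have : Nonempty (Fin n) := ⟨⟨0, hn⟩⟩
  obtain ⟨N, hNm, hN⟩ := exists_measurable_normalize (EuclideanSpace ℝ (Fin n))
  obtain ⟨g, hg, hΩg⟩ := hint.1.aemeasurable
  constructor <;> intro H
  · obtain ⟨C, hC, c, hc, hc1, h⟩ := exists_omegaTrans_le_omegaRot hhom hint hg hΩg hNm hN
    refine lintegral_div_lt_top_of_le_comp_mul (by norm_num) hc hc1 hC h
      (M := incrementBound n Ω) (fun δ hδ => Real.sSup_le ?_ ENNReal.toReal_nonneg) H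
    rintro _ ⟨h, hh, rfl⟩
    exact (increment_translation hhom hint hg hΩg hNm hN (hh.trans_lt hδ.2)).2
  · refine lintegral_div_lt_top_of_le_comp_mul (c := 1 / 2) two_pos (by norm_num) (by norm_num)
      (by positivity : (0 : ℝ) ≤ 1 + 2 ^ n)
      (fun δ hδ => omegaRot_le_omegaTrans hhom hint hg hΩg hNm hN hδ.1 (by linarith [hδ.2]))
      (M := incrementBound n Ω) (fun δ _ => Real.sSup_le ?_ ENNReal.toReal_nonneg) H
    rintro _ ⟨ρ, -, -, rfl⟩
    exact (increment_rotation hint hg hΩg ρ).2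
end
end

section
/- The function g(δ) = 4((2π−δ)^{1/2} − (2π)^{1/2} + δ^{1/2}) satisfies ∫₀¹ g(δ)/δ dδ < ∞, while g(δ)/δ → +∞ as δ → 0⁺. Consequently, the degree-zero homogeneous function on ℝ² given on S¹ by Ω(θ) = θ^{−1/2} − (2/π)^{1/2} (θ the arc-length parameter) satisfies the L¹-Dini condition but violates the regularity condition sup_{|ξ|=1} ∫_{S¹} |Ω(θ) − Ω(θ+δξ)| dσ(θ) ≤ C δ ∫_{S¹} |Ω(θ)| dσ(θ) for small δ, for any constant C. -/
open MeasureTheory Filter Set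

noncomputable section

/-- The arc-length parameter `θ ∈ [0, 2π)` of a point of `ℝ²` (junk value `0` at the origin
is irrelevant for integration over the circle). -/
def arcParam (x : EuclideanSpace ℝ (Fin 2)) : ℝ :=
  if 0 ≤ Complex.arg ⟨x 0, x 1⟩ then Complex.arg ⟨x 0, x 1⟩
  else Complex.arg ⟨x 0, x 1⟩ + 2 * Real.pi

/-- The degree-zero homogeneous function on `ℝ²` given on `S¹` by
`Ω(θ) = θ^{-1/2} - (2/π)^{1/2}` in the arc-length parameter `θ`. -/
def OmegaExample (x : EuclideanSpace ℝ (Fin 2)) : ℝ :=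
  arcParam x ^ (-(1 / 2 : ℝ)) - Real.sqrt (2 / Real.pi)

/-- The point of the unit circle of `ℝ²` with arc-length parameter `t`. -/
def circlePoint (t : ℝ) : unitSphere 2 :=
  ⟨!₂[Real.cos t, Real.sin t], by simp [EuclideanSpace.norm_eq]⟩

theorem continuous_circlePoint : Continuous circlePoint := by
  refine Continuous.subtype_mk ?_ _
  refine (PiLp.continuous_toLp 2 _).comp (continuous_pi fun i => ?_)
  fin_cases i
  · exact Real.continuous_cos
  · exact Real.continuous_sin

theorem circlePoint_periodic : Function.Periodic circlePoint (2 * Real.pi) := fun t => by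
  simp [circlePoint]

open scoped Pointwise in
theorem smul_circlePoint_mem_iff {s : Set (unitSphere 2)} {r : ℝ} (hr : 0 < r) (t : ℝ) :
    r • (circlePoint t : EuclideanSpace ℝ (Fin 2)) ∈
      Ioo (0 : ℝ) 1 • ((↑) '' s : Set (EuclideanSpace ℝ (Fin 2))) ↔
      r ∈ Ioo (0 : ℝ) 1 ∧ circlePoint t ∈ s := by
  constructor
  · rintro ⟨r', hr', _, ⟨y, hy, rfl⟩, h⟩
    have hy1 : ‖(y : EuclideanSpace ℝ (Fin 2))‖ = 1 := by simp
    have ht1 : ‖(circlePoint t : EuclideanSpace ℝ (Fin 2))‖ = 1 := by simp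
    have hrr : r' = r := by
      have := congrArg norm h
      simpa [norm_smul, hy1, ht1, abs_of_pos hr, abs_of_pos hr'.1] using this
    subst hrr
    have : y = circlePoint t := Subtype.ext (smul_right_injective _ hr.ne' h)
    exact ⟨hr', this ▸ hy⟩
  · rintro ⟨h1, h2⟩
    exact ⟨r, h1, _, ⟨_, h2, rfl⟩, rfl⟩

open scoped Pointwise in
theorem measurableSet_Ioo_smul_image {s : Set (unitSphere 2)} (hs : MeasurableSet s) :
    MeasurableSet (Ioo (0 : ℝ) 1 • ((↑) '' s : Set (EuclideanSpace ℝ (Fin 2)))) := by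
  rw [← image2_smul, image2_image_right]
  have : image2 (fun (a : ℝ) (b : unitSphere 2) => a • (b : EuclideanSpace ℝ (Fin 2)))
      (Ioo 0 1) s = (↑) '' (homeomorphUnitSphereProd (EuclideanSpace ℝ (Fin 2)) ⁻¹'
        s ×ˢ Iio ⟨1, mem_Ioi.2 one_pos⟩) := by
    rw [← Homeomorph.image_symm, image_image,
      show Ioo (0 : ℝ) 1 = (↑) '' Iio (⟨1, mem_Ioi.2 one_pos⟩ : Ioi (0 : ℝ)) from
        (image_subtype_val_Ioi_Iio (⟨1, mem_Ioi.2 one_pos⟩ : Ioi (0 : ℝ))).symm,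
      image2_image_left, image2_swap, ← image_prod]
    rfl
  rw [this]
  exact (MeasurableEmbedding.subtype_coe (measurableSet_singleton _).compl).measurableSet_image.2
    ((Homeomorph.measurable _) (hs.prod measurableSet_Iio))

open scoped Pointwise in
theorem sphereMeasure_two_apply {s : Set (unitSphere 2)} (hs : MeasurableSet s) :
    sphereMeasure 2 s =
      volume (circlePoint ⁻¹' s ∩ Ioo (-Real.pi) Real.pi) := by
  have hS := measurableSet_Ioo_smul_image hs
  have hA : MeasurableSet (circlePoint ⁻¹' s) := continuous_circlePoint.measurable hs
  set S := Ioo (0 : ℝ) 1 • ((↑) '' s : Set (EuclideanSpace ℝ (Fin 2)))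
  have hvol : volume S = ∫⁻ z : ℂ, S.indicator 1 (Complex.orthonormalBasisOneI.repr z) := by
    rw [Complex.orthonormalBasisOneI.repr.measurePreserving.lintegral_comp
      (measurable_one.indicator hS), lintegral_indicator_one hS]
  have hhalf : ∫⁻ r in Ioi (0 : ℝ), (Ioo (0 : ℝ) 1).indicator (fun r => ENNReal.ofReal r) r
      = ENNReal.ofReal (1 / 2) := by
    rw [lintegral_indicator measurableSet_Ioo, Measure.restrict_restrict measurableSet_Ioo,
      inter_eq_left.2 Ioo_subset_Ioi_self, Measure.restrict_congr_set Ioo_ae_eq_Ioc,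
      ← ofReal_integral_eq_lintegral_ofReal, ← intervalIntegral.integral_of_le zero_le_one]
    · simp
    · exact (intervalIntegrable_iff_integrableOn_Ioc_of_le zero_le_one).1
        (continuous_id.intervalIntegrable _ _)
    · filter_upwards [ae_restrict_mem measurableSet_Ioc] with y hy using hy.1.le
  have key : volume S = ENNReal.ofReal (1 / 2) *
      volume (circlePoint ⁻¹' s ∩ Ioo (-Real.pi) Real.pi) := by
    rw [hvol, ← Complex.lintegral_comp_polarCoord_symm]
    have : ∀ p ∈ polarCoord.target, ENNReal.ofReal p.1 •
        S.indicator 1 (Complex.orthonormalBasisOneI.repr (Complex.polarCoord.symm p)) =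
        (Ioo (0 : ℝ) 1).indicator (fun r => ENNReal.ofReal r) p.1 *
          (circlePoint ⁻¹' s).indicator (1 : ℝ → ENNReal) p.2 := by
      rintro ⟨r, t⟩ ⟨hr, -⟩
      have hp : Complex.orthonormalBasisOneI.repr (Complex.polarCoord.symm (r, t)) =
          r • (circlePoint t : EuclideanSpace ℝ (Fin 2)) := by
        ext i
        fin_cases i <;>
        simp [circlePoint, Complex.orthonormalBasisOneI_repr_apply,
          Complex.cos_ofReal_re, Complex.sin_ofReal_re]
      rw [hp]
      have hm := smul_circlePoint_mem_iff (s := s) hr t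
      by_cases h1 : r ∈ Ioo (0 : ℝ) 1 <;> by_cases h2 : circlePoint t ∈ s <;>
        simp [indicator, S, hm, h1, h2]
    rw [setLIntegral_congr_fun polarCoord.open_target.measurableSet this, polarCoord_target,
      Measure.volume_eq_prod, ← Measure.prod_restrict,
      lintegral_prod_mul, hhalf, lintegral_indicator_one hA, Measure.restrict_apply hA]
    · exact (ENNReal.measurable_ofReal.indicator measurableSet_Ioo).aemeasurable
    · exact (measurable_one.indicator hA).aemeasurable
  rw [sphereMeasure, Measure.toSphere_apply' _ hs, key, ← mul_assoc]
  simp [ENNReal.mul_inv_cancel]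

/-- The surface measure of the unit circle is the arc-length measure. -/
theorem sphereMeasure_two_eq_map :
    sphereMeasure 2 = (volume.restrict (Ioc 0 (2 * Real.pi))).map circlePoint := by
  ext s hs
  have hA : MeasurableSet (circlePoint ⁻¹' s) := continuous_circlePoint.measurable hs
  have hf : ∀ (g : AddSubgroup.zmultiples (2 * Real.pi)) (x : ℝ),
      (circlePoint ⁻¹' s).indicator (1 : ℝ → ENNReal) (g +ᵥ x) =
      (circlePoint ⁻¹' s).indicator 1 x := by
    have : Function.Periodic ((circlePoint ⁻¹' s).indicator (1 : ℝ → ENNReal))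
        (2 * Real.pi) := circlePoint_periodic.comp (s.indicator 1)
    exact this.map_vadd_zmultiples
  have h := (isAddFundamentalDomain_Ioc Real.two_pi_pos (-Real.pi)).setLIntegral_eq
    (isAddFundamentalDomain_Ioc Real.two_pi_pos 0) _ hf
  rw [lintegral_indicator_one hA, lintegral_indicator_one hA, zero_add,
    show -Real.pi + 2 * Real.pi = Real.pi by ring,
    ← Measure.restrict_congr_set (Ioo_ae_eq_Ioc (a := -Real.pi)), Measure.restrict_apply hA] at h
  rw [sphereMeasure_two_apply hs, h, Measure.map_apply continuous_circlePoint.measurable hs]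

theorem integral_sphereMeasure_two {F : EuclideanSpace ℝ (Fin 2) → ℝ} (hF : Measurable F) :
    ∫ θ : unitSphere 2, F θ ∂(sphereMeasure 2) =
      ∫ t in (0 : ℝ)..2 * Real.pi, F (circlePoint t) := by
  have hF' : Measurable fun θ : unitSphere 2 => F θ := hF.comp measurable_subtype_coe
  rw [sphereMeasure_two_eq_map, integral_map continuous_circlePoint.measurable.aemeasurable
    hF'.aestronglyMeasurable,
    intervalIntegral.integral_of_le Real.two_pi_pos.le]

theorem integrable_sphereMeasure_two_iff {F : EuclideanSpace ℝ (Fin 2) → ℝ} (hF : Measurable F) :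
    Integrable (fun θ : unitSphere 2 => F θ) (sphereMeasure 2) ↔
      IntervalIntegrable (fun t => F (circlePoint t)) volume 0 (2 * Real.pi) := by
  have hF' : Measurable fun θ : unitSphere 2 => F θ := hF.comp measurable_subtype_coe
  rw [sphereMeasure_two_eq_map, integrable_map_measure hF'.aestronglyMeasurable
    continuous_circlePoint.measurable.aemeasurable,
    intervalIntegrable_iff_integrableOn_Ioc_of_le Real.two_pi_pos.le]
  rfl

theorem measurable_arcParam : Measurable arcParam := by
  have h : Measurable fun x : EuclideanSpace ℝ (Fin 2) => Complex.arg ⟨x 0, x 1⟩ := by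
    refine Complex.measurable_arg.comp (Continuous.measurable ?_)
    have : (fun x : EuclideanSpace ℝ (Fin 2) => (⟨x 0, x 1⟩ : ℂ)) =
        Complex.orthonormalBasisOneI.repr.symm := by
      ext x
      simp [Complex.mk_eq_add_mul_I]
    rw [this]
    exact LinearIsometryEquiv.continuous _
  exact Measurable.ite (measurableSet_le measurable_const h) h (h.add_const _)

theorem measurable_OmegaExample : Measurable OmegaExample :=
  (measurable_arcParam.pow_const _).sub_const _

theorem arcParam_circlePoint {t : ℝ} (ht : t ∈ Ico 0 (2 * Real.pi)) :
    arcParam (circlePoint t) = t := by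
  have hmk : ∀ s : ℝ, (⟨Real.cos s, Real.sin s⟩ : ℂ) = Complex.cos s + Complex.sin s * Complex.I :=
    fun s => by rw [Complex.mk_eq_add_mul_I]; push_cast; rfl
  have hpi := Real.pi_pos
  rcases le_or_gt t Real.pi with h | h
  · have : Complex.arg ⟨Real.cos t, Real.sin t⟩ = t := by
      rw [hmk, Complex.arg_cos_add_sin_mul_I ⟨by linarith [ht.1], h⟩]
    simp [arcParam, circlePoint, this, ht.1]
  · have : Complex.arg ⟨Real.cos t, Real.sin t⟩ = t - 2 * Real.pi := by
      rw [← Real.cos_sub_two_pi, ← Real.sin_sub_two_pi, hmk,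
        Complex.arg_cos_add_sin_mul_I ⟨by linarith, by linarith [ht.2]⟩]
    simp [arcParam, circlePoint, this, ht.2]

theorem OmegaExample_circlePoint {t : ℝ} (ht : t ∈ Ico 0 (2 * Real.pi)) :
    OmegaExample (circlePoint t) = t ^ (-(1 / 2) : ℝ) - Real.sqrt (2 / Real.pi) := by
  rw [OmegaExample, arcParam_circlePoint ht]

theorem intervalIntegrable_rpow_neg_half (a b : ℝ) :
    IntervalIntegrable (fun t : ℝ => t ^ (-(1 / 2) : ℝ)) volume a b :=
  intervalIntegral.intervalIntegrable_rpow' (by norm_num)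

theorem integral_rpow_neg_half (a b : ℝ) :
    ∫ t in a..b, t ^ (-(1 / 2) : ℝ) = 2 * (√b - √a) := by
  rw [integral_rpow (Or.inl (by norm_num)), Real.sqrt_eq_rpow, Real.sqrt_eq_rpow]
  norm_num
  ring

theorem intervalIntegrable_OmegaExample_circlePoint :
    IntervalIntegrable (fun t => OmegaExample (circlePoint t)) volume 0 (2 * Real.pi) := by
  refine ((intervalIntegrable_rpow_neg_half _ _).sub
    (intervalIntegrable_const (c := Real.sqrt (2 / Real.pi)))).congr_uIoo fun t ht => ?_
  rw [uIoo_of_le Real.two_pi_pos.le] at ht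
  exact (OmegaExample_circlePoint ⟨ht.1.le, ht.2⟩).symm

theorem integral_abs_OmegaExample_rotate {α : ℝ} (h0 : 0 ≤ α) (h1 : α ≤ 2 * Real.pi) :
    ∫ t in (0 : ℝ)..2 * Real.pi,
        |OmegaExample (circlePoint (t + α)) - OmegaExample (circlePoint t)| =
      4 * (√(2 * Real.pi - α) - √(2 * Real.pi) + √α) := by
  have hA : EqOn (fun t : ℝ => t ^ (-(1 / 2) : ℝ) - (t + α) ^ (-(1 / 2) : ℝ))
      (fun t => |OmegaExample (circlePoint (t + α)) - OmegaExample (circlePoint t)|)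
      (uIoo 0 (2 * Real.pi - α)) := by
    intro t ht
    rw [uIoo_of_le (by linarith)] at ht
    have : (t + α) ^ (-(1 / 2) : ℝ) ≤ t ^ (-(1 / 2) : ℝ) :=
      Real.rpow_le_rpow_of_nonpos ht.1 (by linarith) (by norm_num)
    simp only
    rw [OmegaExample_circlePoint ⟨by linarith [ht.1], by linarith [ht.2]⟩,
      OmegaExample_circlePoint ⟨by linarith [ht.1], by linarith [ht.2]⟩, abs_of_nonpos (by linarith)]
    ring
  have hB : EqOn (fun t : ℝ => (t - (2 * Real.pi - α)) ^ (-(1 / 2) : ℝ) - t ^ (-(1 / 2) : ℝ))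
      (fun t => |OmegaExample (circlePoint (t + α)) - OmegaExample (circlePoint t)|)
      (uIoo (2 * Real.pi - α) (2 * Real.pi)) := by
    intro t ht
    rw [uIoo_of_le (by linarith)] at ht
    have : t ^ (-(1 / 2) : ℝ) ≤ (t - (2 * Real.pi - α)) ^ (-(1 / 2) : ℝ) :=
      Real.rpow_le_rpow_of_nonpos (by linarith [ht.1]) (by linarith) (by norm_num)
    simp only
    rw [show t + α = t - (2 * Real.pi - α) + 2 * Real.pi by ring, circlePoint_periodic,
      OmegaExample_circlePoint ⟨by linarith [ht.1], by linarith [ht.2]⟩,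
      OmegaExample_circlePoint ⟨by linarith [ht.1], by linarith [ht.2]⟩, abs_of_nonneg (by linarith)]
    ring
  have iA : IntervalIntegrable (fun t : ℝ => (t + α) ^ (-(1 / 2) : ℝ)) volume
      0 (2 * Real.pi - α) := by
    simpa using (intervalIntegrable_rpow_neg_half (0 + α) (2 * Real.pi)).comp_add_right α
  have iB : IntervalIntegrable (fun t : ℝ => (t - (2 * Real.pi - α)) ^ (-(1 / 2) : ℝ)) volume
      (2 * Real.pi - α) (2 * Real.pi) := by
    simpa using (intervalIntegrable_rpow_neg_half 0 α).comp_sub_right (2 * Real.pi - α)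
  have iA' := ((intervalIntegrable_rpow_neg_half 0 (2 * Real.pi - α)).sub iA)
  have iB' := (iB.sub (intervalIntegrable_rpow_neg_half (2 * Real.pi - α) (2 * Real.pi)))
  rw [← intervalIntegral.integral_add_adjacent_intervals (iA'.congr_uIoo hA) (iB'.congr_uIoo hB),
    ← intervalIntegral.integral_congr_uIoo hA, ← intervalIntegral.integral_congr_uIoo hB,
    intervalIntegral.integral_sub (intervalIntegrable_rpow_neg_half _ _) iA,
    intervalIntegral.integral_sub iB (intervalIntegrable_rpow_neg_half _ _),
    intervalIntegral.integral_comp_add_right (fun t : ℝ => t ^ (-(1 / 2) : ℝ)),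
    intervalIntegral.integral_comp_sub_right (fun t : ℝ => t ^ (-(1 / 2) : ℝ))]
  simp only [integral_rpow_neg_half]
  simp
  ring

theorem integral_abs_OmegaExample_rotate_le {α : ℝ} (h : |α| ≤ 2 * Real.pi) :
    ∫ t in (0 : ℝ)..2 * Real.pi,
        |OmegaExample (circlePoint (t + α)) - OmegaExample (circlePoint t)| ≤ 4 * √|α| := by
  have key : ∀ β : ℝ, 0 ≤ β → β ≤ 2 * Real.pi → ∫ t in (0 : ℝ)..2 * Real.pi,
        |OmegaExample (circlePoint (t + β)) - OmegaExample (circlePoint t)| ≤ 4 * √β := by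
    intro β h0 h1
    rw [integral_abs_OmegaExample_rotate h0 h1]
    have : √(2 * Real.pi - β) ≤ √(2 * Real.pi) := Real.sqrt_le_sqrt (by linarith)
    linarith
  rcases le_total 0 α with h0 | h0
  · rw [abs_of_nonneg h0] at h ⊢
    exact key α h0 h
  · rw [abs_of_nonpos h0] at h ⊢
    refine le_trans (le_of_eq ?_) (key (-α) (by linarith) h)
    have hp : Function.Periodic (fun t => |OmegaExample (circlePoint (t + α)) -
        OmegaExample (circlePoint t)|) (2 * Real.pi) := fun t => by
      simp only [circlePoint_periodic t, add_right_comm t _ α, circlePoint_periodic (t + α)]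
    have h2 := intervalIntegral.integral_comp_add_right (a := 0) (b := 2 * Real.pi)
      (fun t => |OmegaExample (circlePoint (t + α)) - OmegaExample (circlePoint t)|) (-α)
    have h3 := hp.intervalIntegral_add_eq 0 (-α)
    rw [zero_add] at h3
    rw [h3, add_comm (-α), ← zero_add (-α), ← add_assoc, add_zero, ← h2]
    refine intervalIntegral.integral_congr fun t _ => ?_
    simp [abs_sub_comm]

theorem repr_exp_mul_I (t : ℝ) :
    Complex.orthonormalBasisOneI.repr (Complex.exp (t * Complex.I)) = circlePoint t := by
  ext i
  fin_cases i <;>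
  simp [circlePoint, Complex.orthonormalBasisOneI_repr_apply, Complex.exp_ofReal_mul_I_re,
    Complex.exp_ofReal_mul_I_im]

/-- Every rotation of the plane translates the arc-length parameter. -/
theorem exists_rotation_angle
    (ρ : EuclideanSpace ℝ (Fin 2) ≃ₗᵢ[ℝ] EuclideanSpace ℝ (Fin 2))
    (hρ : LinearMap.det
      (ρ.toLinearEquiv : EuclideanSpace ℝ (Fin 2) →ₗ[ℝ] EuclideanSpace ℝ (Fin 2)) = 1) :
    ∃ α ∈ Ioc (-Real.pi) Real.pi, ∀ t, ρ (circlePoint t) = circlePoint (t + α) := by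
  set e := Complex.orthonormalBasisOneI.repr
  obtain ⟨a, ha | ha⟩ := linear_isometry_complex ((e.trans ρ).trans e.symm)
  · refine ⟨Complex.arg a, Complex.arg_mem_Ioc _, fun t => ?_⟩
    have h := congrArg e (DFunLike.congr_fun ha (Complex.exp (t * Complex.I)))
    have ha' : (a : ℂ) = Complex.exp (Complex.arg a * Complex.I) := by
      have h := Complex.norm_mul_exp_arg_mul_I (a : ℂ)
      rw [Circle.norm_coe, Complex.ofReal_one, one_mul] at h
      exact h.symm
    simp only [LinearIsometryEquiv.trans_apply, LinearIsometryEquiv.apply_symm_apply,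
      rotation_apply] at h
    rw [← repr_exp_mul_I, ← repr_exp_mul_I, h]
    congr 1
    nth_rewrite 1 [ha']
    rw [← Complex.exp_add]
    push_cast
    congr 1
    ring
  · exfalso
    have h1 : LinearMap.det
        (((e.trans ρ).trans e.symm).toLinearEquiv : ℂ →ₗ[ℝ] ℂ) = 1 := by
      rw [← hρ]
      exact LinearMap.det_conj
        (ρ.toLinearEquiv : EuclideanSpace ℝ (Fin 2) →ₗ[ℝ] EuclideanSpace ℝ (Fin 2))
        e.symm.toLinearEquiv
    have h2 : LinearMap.det
        ((Complex.conjLIE.trans (rotation a)).toLinearEquiv : ℂ →ₗ[ℝ] ℂ) = -1 := by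
      have : ((Complex.conjLIE.trans (rotation a)).toLinearEquiv : ℂ →ₗ[ℝ] ℂ) =
          ((rotation a).toLinearEquiv : ℂ →ₗ[ℝ] ℂ) ∘ₗ
            (Complex.conjLIE.toLinearEquiv : ℂ →ₗ[ℝ] ℂ) := rfl
      rw [this, LinearMap.det_comp, det_rotation, Complex.det_conjLIE, one_mul]
    rw [ha, h2] at h1
    norm_num at h1

theorem omegaRot_OmegaExample_le (δ : ℝ) :
    omegaRot 2 OmegaExample δ ≤ 4 * √(Real.pi / 2 * δ) := by
  refine Real.sSup_le ?_ (by positivity)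
  rintro _ ⟨ρ, hdet, hρ, rfl⟩
  obtain ⟨α, hα, hrot⟩ := exists_rotation_angle ρ hdet
  have hmeas : Measurable fun x => |OmegaExample (ρ x) - OmegaExample x| := by
    have := (measurable_OmegaExample.comp ρ.continuous.measurable).sub measurable_OmegaExample
    exact this.abs
  have hαabs : |α| ≤ Real.pi / 2 * δ := by
    have h := hρ (circlePoint 0) (by simp)
    rw [hrot, zero_add, ← repr_exp_mul_I, ← repr_exp_mul_I, ← map_sub,
      LinearIsometryEquiv.norm_map] at h
    simp only [Complex.ofReal_zero, zero_mul, Complex.exp_zero] at h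
    have h' := Complex.angle_le_mul_norm_sub (Complex.norm_exp_ofReal_mul_I α) norm_one
    rw [Complex.angle_one_right (Complex.exp_ne_zero _), Complex.arg_exp_mul_I,
      (toIocMod_eq_self _).2 ⟨hα.1, by linarith [hα.2]⟩] at h'
    exact h'.trans (by gcongr)
  rw [integral_sphereMeasure_two hmeas]
  simp only [hrot]
  refine (integral_abs_OmegaExample_rotate_le ?_).trans (by gcongr)
  have := Real.pi_pos
  exact (abs_le.2 ⟨hα.1.le, hα.2⟩).trans (by linarith)

theorem lintegral_div_lt_top_of_le_sqrt {f : ℝ → ℝ} {C : ℝ}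
    (h : ∀ δ ∈ Ioo (0 : ℝ) 1, f δ ≤ C * √δ) :
    ∫⁻ δ in Ioo (0 : ℝ) 1, ENNReal.ofReal (f δ / δ) < ⊤ := by
  have hint : IntegrableOn (fun t : ℝ => C * t ^ (-(1 / 2) : ℝ)) (Ioo 0 1) :=
    ((intervalIntegrable_iff_integrableOn_Ioo_of_le zero_le_one).1
      (intervalIntegrable_rpow_neg_half 0 1)).const_mul C
  refine lt_of_le_of_lt (setLIntegral_mono' measurableSet_Ioo fun δ hδ => ?_)
    hint.lintegral_lt_top
  refine ENNReal.ofReal_le_ofReal ?_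
  rw [div_le_iff₀ hδ.1, mul_assoc]
  refine (h δ hδ).trans (le_of_eq ?_)
  rw [Real.sqrt_eq_rpow, ← Real.rpow_add_one hδ.1.ne']
  norm_num

theorem L1Dini_OmegaExample : L1Dini 2 OmegaExample := by
  refine ⟨(integrable_sphereMeasure_two_iff measurable_OmegaExample).2
    intervalIntegrable_OmegaExample_circlePoint, ?_⟩
  refine lintegral_div_lt_top_of_le_sqrt (C := 4 * √(Real.pi / 2)) fun δ hδ => ?_
  refine (omegaRot_OmegaExample_le δ).trans (le_of_eq ?_)
  rw [Real.sqrt_mul (by positivity), mul_assoc]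

theorem tendsto_modulus_div_atTop :
    Tendsto
      (fun δ : ℝ =>
        (4 * (Real.sqrt (2 * Real.pi - δ) - Real.sqrt (2 * Real.pi) + Real.sqrt δ)) / δ)
      (nhdsWithin 0 (Ioi 0)) atTop := by
  have hlim : Tendsto (fun δ : ℝ => 4 * δ ^ (-(1 / 2) : ℝ) - 4) (nhdsWithin 0 (Ioi 0)) atTop :=
    tendsto_atTop_add_const_right _ _
      ((tendsto_rpow_neg_nhdsGT_zero (by norm_num)).const_mul_atTop (by norm_num))
  refine tendsto_atTop_mono' _ ?_ hlim
  filter_upwards [Ioo_mem_nhdsGT (zero_lt_one (α := ℝ))] with δ hδ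
  have hpi := Real.pi_gt_three
  have hs : δ ^ (-(1 / 2) : ℝ) * δ = √δ := by
    rw [Real.sqrt_eq_rpow, ← Real.rpow_add_one hδ.1.ne']
    norm_num
  have h1 : √(2 * Real.pi) - δ ≤ √(2 * Real.pi - δ) := by
    refine Real.le_sqrt_of_sq_le ?_
    have h2 : 1 ≤ √(2 * Real.pi) := Real.one_le_sqrt.2 (by linarith)
    nlinarith [Real.sq_sqrt (show 0 ≤ 2 * Real.pi by linarith), hδ.1, hδ.2,
      mul_nonneg hδ.1.le (sub_nonneg.2 h2)]
  rw [le_div_iff₀ hδ.1]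
  nlinarith

theorem pi_le_arcParam_of_neg {x : EuclideanSpace ℝ (Fin 2)} (hx : x 1 < 0) :
    Real.pi ≤ arcParam x := by
  have h : Complex.arg ⟨x 0, x 1⟩ < 0 := Complex.arg_neg_iff.2 hx
  rw [arcParam, if_neg (not_le.2 h)]
  linarith [Complex.neg_pi_lt_arg ⟨x 0, x 1⟩]

theorem arcParam_eq_arg_of_nonneg {x : EuclideanSpace ℝ (Fin 2)} (hx : 0 ≤ x 1) :
    arcParam x = Complex.arg ⟨x 0, x 1⟩ :=
  if_pos (Complex.arg_nonneg_iff.2 hx)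

/-- The point of the unit circle with parameter `t`, moved down by `sin a`. -/
def loweredPoint (a t : ℝ) : EuclideanSpace ℝ (Fin 2) :=
  (circlePoint t : EuclideanSpace ℝ (Fin 2)) + Real.sin a • !₂[0, -1]

theorem loweredPoint_apply_zero (a t : ℝ) : loweredPoint a t 0 = Real.cos t := by
  simp [loweredPoint, circlePoint]

theorem loweredPoint_apply_one (a t : ℝ) : loweredPoint a t 1 = Real.sin t - Real.sin a := by
  simp [loweredPoint, circlePoint, sub_eq_add_neg]

theorem abs_sub_le_arcParam_loweredPoint {a t : ℝ} (ha : a ∈ Ioc 0 (Real.pi / 6))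
    (ht : t ∈ Ico 0 (2 * Real.pi)) :
    |t - a| / (2 * Real.pi) ≤ arcParam (loweredPoint a t) := by
  have hpi := Real.pi_gt_three
  obtain ⟨ha0, ha6⟩ := ha
  obtain ⟨ht0, ht1⟩ := ht
  rw [div_le_iff₀ Real.two_pi_pos]
  rcases lt_or_ge (Real.sin t) (Real.sin a) with hy | hy
  · have h := pi_le_arcParam_of_neg (x := loweredPoint a t)
      (by rw [loweredPoint_apply_one]; linarith)
    have : |t - a| ≤ 2 * Real.pi := abs_le.2 ⟨by linarith, by linarith⟩
    nlinarith
  have hsa : 0 < Real.sin a := Real.sin_pos_of_pos_of_lt_pi ha0 (by linarith)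
  have hat : a ≤ t := by
    by_contra! hlt
    exact absurd (Real.sin_lt_sin_of_lt_of_le_pi_div_two (by linarith) (by linarith) hlt)
      (not_lt.2 hy)
  have htpi : t ≤ Real.pi := by
    by_contra! hlt
    have := Real.sin_neg_of_neg_of_neg_pi_lt (x := t - 2 * Real.pi) (by linarith) (by linarith)
    rw [Real.sin_sub_two_pi] at this
    linarith
  rw [abs_of_nonneg (sub_nonneg.2 hat), arcParam_eq_arg_of_nonneg
    (by rw [loweredPoint_apply_one]; linarith), loweredPoint_apply_zero, loweredPoint_apply_one]
  set z : ℂ := ⟨Real.cos t, Real.sin t - Real.sin a⟩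
  have harg : 0 ≤ z.arg := Complex.arg_nonneg_iff.2 (sub_nonneg.2 hy)
  rcases lt_or_ge (Real.cos t) 0 with hx | hx
  · have : Real.pi / 2 < z.arg := by
      by_contra! hle
      have := Complex.arg_le_pi_div_two_iff.1 hle
      rcases this with h | h
      · exact absurd hx (not_lt.2 h)
      · exact absurd (show 0 ≤ z.im from sub_nonneg.2 hy) (not_le.2 h)
    nlinarith
  · have ht2 : t ≤ Real.pi / 2 := by
      by_contra! hlt
      exact absurd (Real.cos_neg_of_pi_div_two_lt_of_lt hlt (by linarith)) (not_lt.2 hx)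
    have hz : ‖z‖ ≤ 2 := by
      refine (Complex.norm_le_abs_re_add_abs_im z).trans ?_
      have h1 : |z.re| ≤ 1 := Real.abs_cos_le_one t
      have h2 : |z.im| ≤ 1 := abs_le.2
        ⟨by simp only [z]; linarith, by simp only [z]; linarith [Real.sin_le_one t]⟩
      linarith
    have h1 : z.im / 2 ≤ z.arg := by
      refine le_trans ?_ (Real.sin_le harg)
      rw [Complex.sin_arg]
      have hzim : 0 ≤ z.im := sub_nonneg.2 hy
      rcases (norm_nonneg z).eq_or_lt with h0 | h0
      · have : z = 0 := norm_eq_zero.1 h0.symm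
        simp [this]
      · exact div_le_div_of_nonneg_left hzim h0 hz
    have h2 : z.im = 2 * Real.sin ((t - a) / 2) * Real.cos ((t + a) / 2) :=
      Real.sin_sub_sin t a
    have h3 : 2 / Real.pi * ((t - a) / 2) ≤ Real.sin ((t - a) / 2) :=
      Real.mul_le_sin (by linarith) (by linarith)
    have h4 : 1 / 2 ≤ Real.cos ((t + a) / 2) := by
      rw [← Real.cos_pi_div_three]
      exact Real.cos_le_cos_of_nonneg_of_le_pi (by linarith) (by linarith) (by linarith)
    have h5 : (t - a) / Real.pi ≤ Real.sin ((t - a) / 2) := by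
      refine le_trans (le_of_eq ?_) h3
      ring
    have h6 : (t - a) / Real.pi ≤ z.im := by
      have h7 : 0 ≤ (t - a) / Real.pi := div_nonneg (by linarith) (by linarith)
      nlinarith
    rw [div_le_iff₀ Real.pi_pos] at h6
    nlinarith

theorem intervalIntegrable_abs_rpow_neg_half (a b : ℝ) :
    IntervalIntegrable (fun t : ℝ => |t| ^ (-(1 / 2) : ℝ)) volume a b := by
  have key : ∀ c : ℝ, 0 ≤ c → IntervalIntegrable (fun t : ℝ => |t| ^ (-(1 / 2) : ℝ)) volume 0 c := by
    intro c hc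
    refine (intervalIntegrable_rpow_neg_half 0 c).congr_uIoo fun t ht => ?_
    rw [uIoo_of_le hc] at ht
    simp only [abs_of_pos ht.1]
  have key' : ∀ c : ℝ, IntervalIntegrable (fun t : ℝ => |t| ^ (-(1 / 2) : ℝ)) volume 0 c := by
    intro c
    rcases le_total 0 c with hc | hc
    · exact key c hc
    · rw [IntervalIntegrable.iff_comp_neg]
      simpa using key (-c) (by linarith)
  exact (key' a).symm.trans (key' b)

theorem measurable_OmegaExample_loweredPoint (a : ℝ) :
    Measurable fun t => OmegaExample (loweredPoint a t) :=
  measurable_OmegaExample.comp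
    ((continuous_subtype_val.comp continuous_circlePoint).add continuous_const).measurable

theorem intervalIntegrable_OmegaExample_loweredPoint {a : ℝ} (ha : a ∈ Ioc 0 (Real.pi / 6)) :
    IntervalIntegrable (fun t => OmegaExample (loweredPoint a t)) volume 0 (2 * Real.pi) := by
  have hpow : IntervalIntegrable (fun t => (arcParam (loweredPoint a t)) ^ (-(1 / 2) : ℝ))
      volume 0 (2 * Real.pi) := by
    have hdom : IntervalIntegrable
        (fun t : ℝ => (2 * Real.pi) ^ (1 / 2 : ℝ) * |t - a| ^ (-(1 / 2) : ℝ))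
        volume 0 (2 * Real.pi) := by
      refine IntervalIntegrable.const_mul ?_ _
      simpa using (intervalIntegrable_abs_rpow_neg_half (0 - a) (2 * Real.pi - a)).comp_sub_right a
    have hm : Measurable fun t => (arcParam (loweredPoint a t)) ^ (-(1 / 2) : ℝ) := by
      simpa [OmegaExample] using
        (measurable_OmegaExample_loweredPoint a).add_const (Real.sqrt (2 / Real.pi))
    refine hdom.mono_fun' hm.aestronglyMeasurable ?_
    rw [uIoc_of_le Real.two_pi_pos.le, ← Measure.restrict_congr_set Ioo_ae_eq_Ioc]
    filter_upwards [ae_restrict_mem measurableSet_Ioo,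
      ae_restrict_of_ae (Measure.ae_ne volume a)] with t ht hta
    have hpos : 0 < |t - a| := abs_pos.2 (sub_ne_zero.2 hta)
    have hle := abs_sub_le_arcParam_loweredPoint ha ⟨ht.1.le, ht.2⟩
    have hq : 0 < |t - a| / (2 * Real.pi) := div_pos hpos Real.two_pi_pos
    rw [Real.norm_of_nonneg (Real.rpow_nonneg (hq.le.trans hle) _)]
    refine (Real.rpow_le_rpow_of_nonpos hq hle (by norm_num)).trans (le_of_eq ?_)
    rw [Real.div_rpow hpos.le Real.two_pi_pos.le, Real.rpow_neg Real.two_pi_pos.le, div_inv_eq_mul,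
      mul_comm]
  exact hpow.sub (intervalIntegrable_const (c := Real.sqrt (2 / Real.pi)))

theorem two_mul_sqrt_sub_le_integral {a : ℝ} (ha : a ∈ Ioc 0 (Real.pi / 6)) :
    2 * √a - a ≤ ∫ t in (0 : ℝ)..2 * Real.pi,
      |OmegaExample (circlePoint t) - OmegaExample (loweredPoint a t)| := by
  have hpi := Real.pi_gt_three
  have ha2 : a ≤ 2 * Real.pi := by linarith [ha.2]
  have hint := (intervalIntegrable_OmegaExample_circlePoint.sub
    (intervalIntegrable_OmegaExample_loweredPoint ha)).abs
  have hlow : IntervalIntegrable (fun t : ℝ => t ^ (-(1 / 2) : ℝ) - 1) volume 0 a :=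
    (intervalIntegrable_rpow_neg_half 0 a).sub intervalIntegrable_const
  calc 2 * √a - a = ∫ t in (0 : ℝ)..a, (t ^ (-(1 / 2) : ℝ) - 1) := by
        rw [intervalIntegral.integral_sub (intervalIntegrable_rpow_neg_half 0 a)
          intervalIntegrable_const, integral_rpow_neg_half]
        simp
    _ ≤ ∫ t in (0 : ℝ)..a, |OmegaExample (circlePoint t) - OmegaExample (loweredPoint a t)| := by
        refine intervalIntegral.integral_mono_on_of_le_Ioo ha.1.le hlow
          (hint.mono_set ?_) fun t ht => ?_
        · rw [uIcc_of_le ha.1.le, uIcc_of_le Real.two_pi_pos.le]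
          exact Icc_subset_Icc_right ha2
        · have hsin : Real.sin t < Real.sin a :=
            Real.sin_lt_sin_of_lt_of_le_pi_div_two (by linarith [ht.1]) (by linarith [ha.2]) ht.2
          have harc := pi_le_arcParam_of_neg (x := loweredPoint a t)
            (by rw [loweredPoint_apply_one]; linarith)
          have hone : arcParam (loweredPoint a t) ^ (-(1 / 2) : ℝ) ≤ 1 :=
            Real.rpow_le_one_of_one_le_of_nonpos (by linarith) (by norm_num)
          refine le_trans ?_ (le_abs_self _)
          rw [OmegaExample_circlePoint ⟨ht.1.le, by linarith [ht.2]⟩, OmegaExample]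
          linarith
    _ ≤ _ := intervalIntegral.integral_mono_interval le_rfl ha.1.le ha2
        (Eventually.of_forall fun t => abs_nonneg _) hint

theorem OmegaExample_not_regular (C δ₀ : ℝ) (hδ₀ : 0 < δ₀) :
    ∃ δ : ℝ, 0 < δ ∧ δ < δ₀ ∧
      ∃ ξ : EuclideanSpace ℝ (Fin 2), ‖ξ‖ = 1 ∧
        C * δ * (∫ θ : unitSphere 2, |OmegaExample (θ : EuclideanSpace ℝ (Fin 2))|
            ∂(sphereMeasure 2)) <
          ∫ θ : unitSphere 2,
            |OmegaExample (θ : EuclideanSpace ℝ (Fin 2)) -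
              OmegaExample ((θ : EuclideanSpace ℝ (Fin 2)) + δ • ξ)| ∂(sphereMeasure 2) := by
  set K := ∫ θ : unitSphere 2, |OmegaExample (θ : EuclideanSpace ℝ (Fin 2))| ∂(sphereMeasure 2)
  have hpi := Real.pi_gt_three
  set M := |C * K| + 1
  have hM : 1 ≤ M := le_add_of_nonneg_left (abs_nonneg _)
  obtain ⟨a, ha0, ha⟩ := exists_between
    (show 0 < min δ₀ (min (Real.pi / 6) (1 / M ^ 2)) from
      lt_min hδ₀ (lt_min (by positivity) (by positivity)))
  obtain ⟨haδ, ha⟩ := lt_min_iff.1 ha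
  obtain ⟨ha6, haM⟩ := lt_min_iff.1 ha
  have hsin : Real.sin a < a := Real.sin_lt ha0
  have hsin0 : 0 < Real.sin a := Real.sin_pos_of_pos_of_lt_pi ha0 (by linarith)
  refine ⟨Real.sin a, hsin0, hsin.trans haδ, !₂[0, -1], by simp [EuclideanSpace.norm_eq], ?_⟩
  have hmeas : Measurable fun x =>
      |OmegaExample x - OmegaExample (x + Real.sin a • !₂[0, -1])| :=
    (measurable_OmegaExample.sub
      (measurable_OmegaExample.comp (measurable_id.add_const _))).abs
  rw [integral_sphereMeasure_two hmeas]
  refine lt_of_lt_of_le ?_ (two_mul_sqrt_sub_le_integral ⟨ha0, ha6.le⟩)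
  have hsqrt : 0 < √a := Real.sqrt_pos.2 ha0
  have hMs : M * √a < 1 := by
    have : √a < 1 / M := by
      rw [Real.sqrt_lt' (by positivity), div_pow, one_pow]
      exact haM
    rwa [lt_div_iff₀ (by positivity), mul_comm] at this
  have hMa : M * a < √a := by
    nlinarith [Real.mul_self_sqrt ha0.le]
  have hCK : C * Real.sin a * K ≤ |C * K| * a := by
    calc C * Real.sin a * K = C * K * Real.sin a := by ring
      _ ≤ |C * K| * Real.sin a := by gcongr; exact le_abs_self _
      _ ≤ |C * K| * a := by gcongr
  have : M * a = |C * K| * a + a := by ring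
  linarith

/-- The function `g(δ) = 4((2π-δ)^{1/2} - (2π)^{1/2} + δ^{1/2})` satisfies
`∫₀¹ g(δ)/δ dδ < ∞` while `g(δ)/δ → +∞` as `δ → 0⁺`; consequently the example
`Ω(θ) = θ^{-1/2} - (2/π)^{1/2}` satisfies the `L¹`-Dini condition but, for any constant
`C`, violates the regularity condition for small `δ`. -/
theorem omegaExample_dini_but_not_regular :
    (∫⁻ δ in Ioo (0 : ℝ) 1,
        ENNReal.ofReal
          ((4 * (Real.sqrt (2 * Real.pi - δ) - Real.sqrt (2 * Real.pi) + Real.sqrt δ)) / δ)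
      < ⊤) ∧
    (Tendsto
      (fun δ : ℝ =>
        (4 * (Real.sqrt (2 * Real.pi - δ) - Real.sqrt (2 * Real.pi) + Real.sqrt δ)) / δ)
      (nhdsWithin 0 (Ioi 0)) atTop) ∧
    L1Dini 2 OmegaExample ∧
    (∀ C : ℝ, ∀ δ₀ : ℝ, 0 < δ₀ → ∃ δ : ℝ, 0 < δ ∧ δ < δ₀ ∧
      ∃ ξ : EuclideanSpace ℝ (Fin 2), ‖ξ‖ = 1 ∧
        C * δ * (∫ θ : unitSphere 2, |OmegaExample (θ : EuclideanSpace ℝ (Fin 2))|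
            ∂(sphereMeasure 2)) <
          ∫ θ : unitSphere 2,
            |OmegaExample (θ : EuclideanSpace ℝ (Fin 2)) -
              OmegaExample ((θ : EuclideanSpace ℝ (Fin 2)) + δ • ξ)| ∂(sphereMeasure 2)) := by
  refine ⟨?_, tendsto_modulus_div_atTop, L1Dini_OmegaExample, OmegaExample_not_regular⟩
  refine lintegral_div_lt_top_of_le_sqrt (C := 4) fun δ hδ => ?_
  have : √(2 * Real.pi - δ) ≤ √(2 * Real.pi) := Real.sqrt_le_sqrt (by linarith [hδ.1])
  linarith
end
end
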